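/- arXiv:2310.03382 — 6 statements merged into one kernel-verified Lean document; each statement's English description precedes it below -/
import Mathlib

section
/- Let p ≥ 5 be a prime. Then there exists a p-progression-free subset S of F_p^3 with |S| ≥ p^3 - 3p^2 + 4p - 2·√p - 1 (equivalently, r_p(F_p^3) ≥ (p-1)^3 + p - 2√p, where √p denotes the real square root of p). -/
/-- A subset `S` of `F_p^n` is `k`-progression-free if there are no `a, d` with `d ≠ 0`
such that `a + i • d ∈ S` for all `i ∈ {0, …, k-1}`. -/
def ProgFree (p n k : ℕ) (S : Finset (Fin n → ZMod p)) : Prop :=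
  ¬ ∃ a d : Fin n → ZMod p, d ≠ 0 ∧ ∀ i : ℕ, i < k → a + (i : ZMod p) • d ∈ S

/-- Base-`a` digit set: `p` points, one on each line `x + a z = c`. -/
def digU (p a : ℕ) : Finset (ZMod p × ZMod p) :=
  (Finset.range p).image (fun r : ℕ => (((r % a : ℕ) : ZMod p), ((r / a : ℕ) : ZMod p)))

/-- The level sets of the progression-free set. -/
def lev (p a : ℕ) [NeZero p] (y : ZMod p) : Finset (ZMod p × ZMod p) :=
  if y = 0 then (digU p a).filter (fun w => w.1 ≠ 0 ∧ w.2 ≠ 0)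
  else if y = 1 then
    Finset.univ.filter (fun w => w ∉ digU p a ∧ w.1 + (a : ZMod p) * w.2 ≠ 0)
  else (Finset.univ.erase 0) ×ˢ (Finset.univ.erase 0)

/-- The set itself. -/
def bigS (p a : ℕ) [NeZero p] : Finset (Fin 3 → ZMod p) :=
  Finset.univ.filter (fun v => (v 0, v 2) ∈ lev p a (v 1))

lemma digU_mem (p a : ℕ) (x z : ZMod p) :
    (x, z) ∈ digU p a ↔
      ∃ r : ℕ, r < p ∧ ((r % a : ℕ) : ZMod p) = x ∧ ((r / a : ℕ) : ZMod p) = z := by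
  simp [digU]

lemma digU_lin (p a r : ℕ) :
    ((r % a : ℕ) : ZMod p) + (a : ZMod p) * ((r / a : ℕ) : ZMod p) = (r : ZMod p) := by
  exact_mod_cast congrArg (Nat.cast (R := ZMod p)) (Nat.mod_add_div r a)

lemma digU_down (p a : ℕ) (ha : 0 < a) (x z x' z' : ZMod p) (h : (x, z) ∈ digU p a)
    (hx : x' = 0 ∨ x' = x) (hz : z' = 0 ∨ z' = z) : (x', z') ∈ digU p a := by
  rw [digU_mem] at h ⊢
  obtain ⟨r, hr, rfl, rfl⟩ := h
  have hm := Nat.mod_add_div r a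
  rcases hx with rfl | rfl <;> rcases hz with rfl | rfl
  · exact ⟨0, by omega, by simp, by simp⟩
  · refine ⟨a * (r / a), by omega, by simp, by rw [Nat.mul_div_cancel_left _ ha]⟩
  · refine ⟨r % a, by omega, by simp, by rw [Nat.div_eq_of_lt (Nat.mod_lt _ ha)]; simp⟩
  · exact ⟨r, hr, rfl, rfl⟩

lemma digU_card (p a : ℕ) : (digU p a).card = p := by
  rw [digU, Finset.card_image_of_injOn, Finset.card_range]
  intro r hr s hs h
  simp only [Finset.coe_range, Set.mem_Iio] at hr hs
  simp only [Prod.mk.injEq] at h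
  have h2 : (r : ZMod p) = (s : ZMod p) := by
    rw [← digU_lin p a r, ← digU_lin p a s, h.1, h.2]
  rw [ZMod.natCast_eq_natCast_iff'] at h2
  rwa [Nat.mod_eq_of_lt hr, Nat.mod_eq_of_lt hs] at h2

lemma lev_zero (p a : ℕ) [NeZero p] :
    lev p a 0 = (digU p a).filter (fun w => w.1 ≠ 0 ∧ w.2 ≠ 0) := by
  simp [lev]

lemma lev_one (p a : ℕ) [Fact p.Prime] : lev p a 1 =
    Finset.univ.filter (fun w => w ∉ digU p a ∧ w.1 + (a : ZMod p) * w.2 ≠ 0) := by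
  simp [lev]

lemma lev_ne (p a : ℕ) [NeZero p] (y : ZMod p) (h1 : y ≠ 1) (w : ZMod p × ZMod p)
    (h : w ∈ lev p a y) : w.1 ≠ 0 ∧ w.2 ≠ 0 := by
  unfold lev at h
  split_ifs at h with h0
  · simpa using (Finset.mem_filter.1 h).2
  · simpa [Finset.mem_product] using h

lemma lev_zero_card (p a b : ℕ) [Fact p.Prime] (ha : 0 < a) (hap : a ≤ p) (hab : p ≤ a * b) :
    p + 1 ≤ (lev p a 0).card + (a + b) := by
  rw [lev_zero]
  have h1 := Finset.card_filter_add_card_filter_not (s := digU p a)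
    (fun w : ZMod p × ZMod p => w.1 ≠ 0 ∧ w.2 ≠ 0)
  rw [digU_card] at h1
  have h2 : (digU p a).filter (fun w => ¬ (w.1 ≠ 0 ∧ w.2 ≠ 0)) ⊆
      ((Finset.range b).image (fun j : ℕ => ((0 : ZMod p), (j : ZMod p)))) ∪
      ((Finset.Ico 1 a).image (fun i : ℕ => ((i : ZMod p), (0 : ZMod p)))) := by
    rintro ⟨x, z⟩ hw
    rw [Finset.mem_filter, digU_mem] at hw
    obtain ⟨⟨r, hr, rfl, rfl⟩, hn⟩ := hw
    have hmod := Nat.mod_lt r ha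
    have hdiv : r / a < b := by
      rw [Nat.div_lt_iff_lt_mul ha, mul_comm]; omega
    rw [Finset.mem_union, Finset.mem_image, Finset.mem_image]
    by_cases h0 : r % a = 0
    · left
      exact ⟨r / a, by simpa using hdiv, by simp [h0]⟩
    · right
      refine ⟨r % a, by simp; omega, ?_⟩
      have hx : ((r % a : ℕ) : ZMod p) ≠ 0 := by
        rw [Ne, ZMod.natCast_eq_zero_iff]
        intro hd
        have := Nat.le_of_dvd (by omega) hd
        omega
      have hz : ((r / a : ℕ) : ZMod p) = 0 := by
        by_contra hz
        exact hn ⟨hx, hz⟩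
      rw [hz]
  have h3 := Finset.card_le_card h2
  have h4 := h3.trans (Finset.card_union_le _ _)
  have h5 := Finset.card_image_le (s := Finset.range b)
    (f := fun j : ℕ => ((0 : ZMod p), (j : ZMod p)))
  have h6 := Finset.card_image_le (s := Finset.Ico 1 a)
    (f := fun i : ℕ => ((i : ZMod p), (0 : ZMod p)))
  simp only [Finset.card_range, Nat.card_Ico] at h5 h6
  omega

lemma lev_one_card (p a : ℕ) [Fact p.Prime] :
    (p - 1) ^ 2 ≤ (lev p a 1).card := by
  have hp : 2 ≤ p := (Fact.out : p.Prime).two_le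
  have h0 : (lev p a 1) =
      (digU p a ∪ Finset.univ.image (fun z : ZMod p => (-(a : ZMod p) * z, z)))ᶜ := by
    rw [lev_one]
    ext ⟨x, z⟩
    simp only [Finset.mem_filter, Finset.mem_univ, true_and, Finset.mem_compl, Finset.mem_union,
      Finset.mem_image, Prod.mk.injEq, not_or, ne_eq]
    refine and_congr_right fun _ => not_congr ⟨fun h => ⟨z, by linear_combination -h, rfl⟩, ?_⟩
    rintro ⟨z', h, rfl⟩
    linear_combination -h
  rw [h0, Finset.card_compl]
  have h1 := Finset.card_union_add_card_inter (digU p a)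
    (Finset.univ.image (fun z : ZMod p => (-(a : ZMod p) * z, z)))
  have h2 : 0 < (digU p a ∩
      (Finset.univ.image (fun z : ZMod p => (-(a : ZMod p) * z, z)))).card := by
    apply Finset.card_pos.2
    refine ⟨(0, 0), Finset.mem_inter.2 ⟨?_, ?_⟩⟩
    · rw [digU_mem]
      exact ⟨0, by omega, by simp, by simp⟩
    · exact Finset.mem_image.2 ⟨0, by simp, by simp⟩
  have h3 := Finset.card_image_le (s := (Finset.univ : Finset (ZMod p)))
    (f := fun z : ZMod p => (-(a : ZMod p) * z, z))
  rw [digU_card] at h1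
  rw [Finset.card_univ, ZMod.card] at h3
  rw [Fintype.card_prod, ZMod.card]
  obtain ⟨q, rfl⟩ : ∃ q, p = q + 1 := ⟨p - 1, by omega⟩
  have : (q + 1) * (q + 1) = q ^ 2 + (2 * q + 1) := by ring
  simp only [Nat.add_sub_cancel]
  omega

lemma lev_other_card (p a : ℕ) [Fact p.Prime] (y : ZMod p) (h0 : y ≠ 0) :
    (p - 1) ^ 2 ≤ (lev p a y).card := by
  by_cases h1 : y = 1
  · rw [h1]; exact lev_one_card p a
  · simp [lev, h0, h1, Finset.card_product, ZMod.card, sq]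

lemma bigS_card (p a : ℕ) [Fact p.Prime] :
    (lev p a 0).card + (p - 1) ^ 3 ≤ (bigS p a).card := by
  have h1 : ((Finset.univ : Finset (ZMod p)).sigma (lev p a)).card ≤ (bigS p a).card := by
    apply Finset.card_le_card_of_injOn (fun w => ![w.2.1, w.1, w.2.2])
    · rintro ⟨y, x, z⟩ h
      simpa [bigS] using h
    · rintro ⟨y, x, z⟩ _ ⟨y', x', z'⟩ _ h
      have e0 := congrFun h 0
      have e1 := congrFun h 1
      have e2 := congrFun h 2
      simp at e0 e1 e2
      subst e0 e1 e2
      rfl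
  rw [Finset.card_sigma, ← Finset.add_sum_erase _ _ (Finset.mem_univ (0 : ZMod p))] at h1
  have h2 := Finset.card_nsmul_le_sum (Finset.univ.erase (0 : ZMod p))
    (fun y => (lev p a y).card) ((p - 1) ^ 2)
    (fun y hy => lev_other_card p a y (Finset.ne_of_mem_erase hy))
  rw [Finset.card_erase_of_mem (Finset.mem_univ _), Finset.card_univ, ZMod.card, smul_eq_mul] at h2
  have : (p - 1) ^ 3 = (p - 1) * (p - 1) ^ 2 := by ring
  omega

lemma aux_dir (p : ℕ) [Fact p.Prime] (q m : ZMod p) (hq : q ≠ 0)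
    (h : ∀ y : ZMod p, y ≠ 1 → q + y * m ≠ 0) : q + m = 0 ∨ q + m = q := by
  by_cases hm : m = 0
  · right; simp [hm]
  · left
    by_contra hne
    have hk : q + (-q / m) * m = 0 := by field_simp; ring
    refine h (-q / m) ?_ hk
    intro h1
    rw [h1] at hk
    exact hne (by simpa using hk)

lemma bigS_free (p a : ℕ) [Fact p.Prime] (ha : 0 < a) : ProgFree p 3 p (bigS p a) := by
  rintro ⟨v, d, hd, hS⟩
  have key : ∀ t : ZMod p, (v 0 + t * d 0, v 2 + t * d 2) ∈ lev p a (v 1 + t * d 1) := by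
    intro t
    have := hS t.val (ZMod.val_lt t)
    simpa [bigS] using this
  clear hS
  by_cases h1 : d 1 = 0
  · simp only [h1, mul_zero, add_zero] at key
    have hd' : d 0 ≠ 0 ∨ d 2 ≠ 0 := by
      by_contra hc
      push Not at hc
      apply hd
      funext i
      fin_cases i <;> simp [hc.1, hc.2, h1]
    by_cases hy : v 1 = 1
    · rw [hy, lev_one] at key
      simp only [Finset.mem_filter, Finset.mem_univ, true_and] at key
      by_cases hk : d 0 + a * d 2 = 0
      · have h2 : d 2 ≠ 0 := by
          intro h2
          rw [h2] at hk
          simp at hk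
          tauto
        set c : ZMod p := v 0 + a * v 2 with hc
        have hl := digU_lin p a c.val
        rw [ZMod.natCast_zmod_val] at hl
        refine (key ((((c.val / a : ℕ) : ZMod p) - v 2) / d 2)).1 ?_
        rw [digU_mem]
        set t := (((c.val / a : ℕ) : ZMod p) - v 2) / d 2 with ht
        have ht2 : t * d 2 = ((c.val / a : ℕ) : ZMod p) - v 2 := by
          rw [ht]; field_simp
        refine ⟨c.val, ZMod.val_lt c, ?_, ?_⟩
        · linear_combination hl + hc - t * hk + a * ht2
        · linear_combination -ht2
      · refine (key (-(v 0 + a * v 2) / (d 0 + a * d 2))).2 ?_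
        field_simp
        ring
    · rcases hd' with h | h
      · refine (lev_ne p a _ hy _ (key (-v 0 / d 0))).1 ?_
        field_simp
        ring
      · refine (lev_ne p a _ hy _ (key (-v 2 / d 2))).2 ?_
        field_simp
        ring
  · -- transversal lines
    obtain ⟨q, m, q', m', hline⟩ : ∃ q m q' m' : ZMod p,
        ∀ y : ZMod p, (q + y * m, q' + y * m') ∈ lev p a y := by
      refine ⟨v 0 - v 1 / d 1 * d 0, d 0 / d 1, v 2 - v 1 / d 1 * d 2, d 2 / d 1, fun y => ?_⟩
      have := key ((y - v 1) / d 1)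
      have e : v 1 + (y - v 1) / d 1 * d 1 = y := by field_simp; ring
      rw [e] at this
      convert this using 2 <;> ring
    have hz := hline 0
    rw [lev_zero] at hz
    simp only [zero_mul, add_zero, Finset.mem_filter] at hz
    obtain ⟨hU, hq, hq'⟩ := hz
    have e1 := aux_dir p q m hq (fun y hy => (lev_ne p a y hy _ (hline y)).1)
    have e2 := aux_dir p q' m' hq' (fun y hy => (lev_ne p a y hy _ (hline y)).2)
    have h3 := hline 1
    rw [lev_one] at h3
    simp only [one_mul, Finset.mem_filter] at h3
    exact h3.2.1 (digU_down p a ha q q' _ _ hU e1 e2)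

theorem stmt_0 (p : ℕ) (hp : p.Prime) (hp5 : 5 ≤ p) :
    ∃ S : Finset (Fin 3 → ZMod p), ProgFree p 3 p S ∧
      (p : ℝ) ^ 3 - 3 * (p : ℝ) ^ 2 + 4 * (p : ℝ) - 2 * Real.sqrt p - 1 ≤ (S.card : ℝ) := by
  haveI : Fact p.Prime := ⟨hp⟩
  obtain ⟨s, hs⟩ : ∃ s, s = Nat.sqrt p := ⟨_, rfl⟩
  have hs1 : s * s ≤ p := hs ▸ Nat.sqrt_le p
  have hs2 : p < (s + 1) * (s + 1) := hs ▸ Nat.lt_succ_sqrt p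
  refine ⟨bigS p (s + 1), bigS_free p (s + 1) (by omega), ?_⟩
  have hap : s + 1 ≤ p := by nlinarith
  have hr0 := Real.sqrt_nonneg (p : ℝ)
  have hr := Real.sq_sqrt (Nat.cast_nonneg (α := ℝ) p)
  obtain ⟨b, hb1, hb2⟩ : ∃ b : ℕ, p ≤ (s + 1) * b ∧ (s : ℝ) + b ≤ 2 * Real.sqrt p := by
    by_cases h : p ≤ (s + 1) * s
    · refine ⟨s, h, ?_⟩
      have : (s : ℝ) ≤ Real.sqrt p := Real.le_sqrt_of_sq_le (by rw [sq]; exact_mod_cast hs1)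
      linarith
    · refine ⟨s + 1, hs2.le, ?_⟩
      have h' : ((s + 1) * s + 1 : ℝ) ≤ p := by
        push Not at h
        exact_mod_cast h
      have : (s : ℝ) + 1 / 2 ≤ Real.sqrt p := Real.le_sqrt_of_sq_le (by nlinarith)
      push_cast
      linarith
  have hc1 := lev_zero_card p (s + 1) b (by omega) hap hb1
  have hc2 := bigS_card p (s + 1)
  have hc1' : (p : ℝ) + 1 ≤ (lev p (s + 1) 0).card + ((s : ℝ) + 1 + b) := by exact_mod_cast hc1
  have hc2' : ((lev p (s + 1) 0).card : ℝ) + ((p : ℝ) - 1) ^ 3 ≤ (bigS p (s + 1)).card := by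
    have := (Nat.cast_le (α := ℝ)).2 hc2
    rw [Nat.cast_add, Nat.cast_pow, Nat.cast_sub (by omega)] at this
    simpa using this
  nlinarith
end

section
/- Let p be a prime with p ≡ 7 (mod 24). Then there exists a p-progression-free subset S of F_p^3 with |S| ≥ (p-1)^3 + (p-1) = p^3 - 3p^2 + 4p - 2. -/
/-- The auxiliary functions `sg`, `tx`, `ty`. -/
lemma exists_aux (p : ℕ) [Fact p.Prime] (hcong : p % 24 = 7) :
    ∃ (χ : ZMod p → ℤ) (sg tx ty : ZMod p → ZMod p),
      (∀ w, w ≠ 0 → χ (-w) = - χ w) ∧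
      (∀ w, w ≠ 0 → (sg w = w ∨ sg w = -w) ∧ χ (sg w) = 1) ∧
      (∀ w, w ≠ 0 → χ (tx w) = -1 ∧ χ (ty w) = 1) ∧
      (∀ w, w ≠ 0 → tx w - ty w = sg w) ∧
      (∀ w, w ≠ 0 → (tx w = -2 * w ∧ ty w = -3 * w) ∨ (tx w = -3 * w ∧ ty w = -2 * w)) := by
  classical
  have hp2 : p ≠ 2 := by omega
  have h2 : IsSquare (2 : ZMod p) := (ZMod.exists_sq_eq_two_iff hp2).2 (by omega)
  have hm1 : ¬ IsSquare (-1 : ZMod p) := by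
    rw [ZMod.exists_sq_eq_neg_one_iff]; omega
  have h3 : ¬ IsSquare (3 : ZMod p) := by
    haveI : Fact (Nat.Prime 3) := ⟨Nat.prime_three⟩
    have := ZMod.exists_sq_eq_prime_iff_of_mod_four_eq_three (p := p) (q := 3) (by omega)
      (by norm_num) (by omega)
    push_cast at this
    rw [this, not_not]
    have h1 : ((p : ℕ) : ZMod 3) = 1 := by
      have : ((p : ℕ) : ZMod 3) = ((1 : ℕ) : ZMod 3) :=
        (ZMod.natCast_eq_natCast_iff' _ _ _).2 (by omega)
      simpa using this
    rw [h1]; exact IsSquare.one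
  have hn : ∀ n : ℕ, 0 < n → n < 7 → ((n : ℕ) : ZMod p) ≠ 0 := by
    intro n h0 h7 h
    rw [ZMod.natCast_eq_zero_iff] at h
    have := Nat.le_of_dvd h0 h
    omega
  have h20 : (2 : ZMod p) ≠ 0 := by simpa using hn 2 (by norm_num) (by norm_num)
  have h30 : (3 : ZMod p) ≠ 0 := by simpa using hn 3 (by norm_num) (by norm_num)
  have c2 : quadraticChar (ZMod p) 2 = 1 := (quadraticChar_one_iff_isSquare h20).2 h2
  have c3 : quadraticChar (ZMod p) 3 = -1 := quadraticChar_neg_one_iff_not_isSquare.2 h3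
  have c1 : quadraticChar (ZMod p) (-1) = -1 := quadraticChar_neg_one_iff_not_isSquare.2 hm1
  have cn : ∀ w, quadraticChar (ZMod p) (-w) = - quadraticChar (ZMod p) w := by
    intro w
    rw [← neg_one_mul, map_mul, c1]; ring
  refine ⟨fun w => quadraticChar (ZMod p) w,
    fun w => if quadraticChar (ZMod p) w = 1 then w else -w,
    fun w => if quadraticChar (ZMod p) w = 1 then -2 * w else -3 * w,
    fun w => if quadraticChar (ZMod p) w = 1 then -3 * w else -2 * w,
    fun w _ => cn w, ?_, ?_, ?_, ?_⟩
  · intro w hw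
    rcases quadraticChar_dichotomy hw with h | h
    · simp [h]
    · simp [h, cn]
  · intro w hw
    rcases quadraticChar_dichotomy hw with h | h
    · simp only [h, if_true, neg_mul, cn, map_mul, c2, c3]
      norm_num
    · have h' : ¬ ((-1 : ℤ) = 1) := by norm_num
      simp only [h, h', if_false, neg_mul, cn, map_mul, c2, c3]
      norm_num
  · intro w hw
    dsimp only
    split_ifs <;> ring
  · intro w hw
    dsimp only
    split_ifs <;> simp

theorem stmt_1 (p : ℕ) (hp : p.Prime) (hcong : p % 24 = 7) :
    ∃ S : Finset (Fin 3 → ZMod p), ProgFree p 3 p S ∧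
      ((p : ℤ) - 1) ^ 3 + ((p : ℤ) - 1) ≤ (S.card : ℤ) := by
  classical
  haveI : Fact p.Prime := ⟨hp⟩
  obtain ⟨χ, sg, tx, ty, hneg, hsg, htc, hdiff, ht⟩ := exists_aux p hcong
  have hn : ∀ n : ℕ, 0 < n → n < 7 → ((n : ℕ) : ZMod p) ≠ 0 := by
    intro n h0 h7 h
    rw [ZMod.natCast_eq_zero_iff] at h
    have := Nat.le_of_dvd h0 h
    omega
  have h20 : (2 : ZMod p) ≠ 0 := by simpa using hn 2 (by norm_num) (by norm_num)
  have h30 : (3 : ZMod p) ≠ 0 := by simpa using hn 3 (by norm_num) (by norm_num)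
  have h50 : (5 : ZMod p) ≠ 0 := by simpa using hn 5 (by norm_num) (by norm_num)
  have hsg0 : ∀ w, w ≠ 0 → sg w ≠ 0 := by
    intro w hw
    rcases (hsg w hw).1 with h | h <;> rw [h] <;> simpa using hw
  have htx0 : ∀ w, w ≠ 0 → tx w ≠ 0 := by
    intro w hw
    rcases ht w hw with h | h <;> rw [h.1] <;> simp [hw, h20, h30]
  have hty0 : ∀ w, w ≠ 0 → ty w ≠ 0 := by
    intro w hw
    rcases ht w hw with h | h <;> rw [h.2] <;> simp [hw, h20, h30]
  let U : Finset (ZMod p) := Finset.univ.filter (fun w => w ≠ 0)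
  have hU : ∀ w, w ∈ U ↔ w ≠ 0 := by intro w; simp [U]
  have hUc : U.card = p - 1 := by
    have : U = Finset.univ.erase 0 := by ext w; simp [U]
    rw [this, Finset.card_erase_of_mem (Finset.mem_univ _), Finset.card_univ, ZMod.card]
  let C : Finset (Fin 3 → ZMod p) := Fintype.piFinset (fun _ => U)
  let R1 := U.image (fun w => (![sg w, -sg w, w] : Fin 3 → ZMod p))
  let R2 := U.image (fun w => (![tx w, ty w, w] : Fin 3 → ZMod p))
  let A1 := U.image (fun w => (![0, -sg w, w] : Fin 3 → ZMod p))
  let A2 := U.image (fun w => (![sg w, 0, w] : Fin 3 → ZMod p))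
  let A3 := U.image (fun w => (![tx w, ty w, 0] : Fin 3 → ZMod p))
  have hC : ∀ v, v ∈ C ↔ v 0 ≠ 0 ∧ v 1 ≠ 0 ∧ v 2 ≠ 0 := by
    intro v
    simp only [C, Fintype.mem_piFinset, hU]
    constructor
    · intro h; exact ⟨h 0, h 1, h 2⟩
    · rintro ⟨h0, h1, h2⟩ i
      fin_cases i <;> assumption
  have hA1 : ∀ v, v ∈ A1 → v 0 = 0 ∧ v 2 ≠ 0 ∧ v 1 = - sg (v 2) := by
    intro v hv
    obtain ⟨w, hw, rfl⟩ := Finset.mem_image.1 hv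
    simpa using (hU w).1 hw
  have hA2 : ∀ v, v ∈ A2 → v 1 = 0 ∧ v 2 ≠ 0 ∧ v 0 = sg (v 2) := by
    intro v hv
    obtain ⟨w, hw, rfl⟩ := Finset.mem_image.1 hv
    simpa using (hU w).1 hw
  have hA3 : ∀ v, v ∈ A3 → v 2 = 0 ∧ ∃ w, w ≠ 0 ∧ v 0 = tx w ∧ v 1 = ty w := by
    intro v hv
    obtain ⟨w, hw, rfl⟩ := Finset.mem_image.1 hv
    exact ⟨by simp, w, (hU w).1 hw, by simp, by simp⟩
  let S := (C \ (R1 ∪ R2)) ∪ (A1 ∪ (A2 ∪ A3))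
  have hS : ∀ v, v ∈ S → (v ∈ C ∧ v ∉ R1 ∧ v ∉ R2) ∨ v ∈ A1 ∨ v ∈ A2 ∨ v ∈ A3 := by
    intro v hv
    simpa [S] using hv
  -- consequences of membership
  have hS0 : ∀ v, v ∈ S → v 0 = 0 → v 2 ≠ 0 ∧ v 1 = - sg (v 2) := by
    intro v hv h0
    rcases hS v hv with h | h | h | h
    · exact absurd h0 ((hC v).1 h.1).1
    · exact (hA1 v h).2
    · obtain ⟨_, h2, h3⟩ := hA2 v h
      exact absurd (h3.symm.trans h0) (hsg0 _ h2)
    · obtain ⟨_, w, hw, h3, _⟩ := hA3 v h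
      exact absurd (h3.symm.trans h0) (htx0 _ hw)
  have hS1 : ∀ v, v ∈ S → v 1 = 0 → v 2 ≠ 0 ∧ v 0 = sg (v 2) := by
    intro v hv h0
    rcases hS v hv with h | h | h | h
    · exact absurd h0 ((hC v).1 h.1).2.1
    · obtain ⟨_, h2, h3⟩ := hA1 v h
      exact absurd (neg_eq_zero.1 (h3.symm.trans h0)) (hsg0 _ h2)
    · exact (hA2 v h).2
    · obtain ⟨_, w, hw, _, h3⟩ := hA3 v h
      exact absurd (h3.symm.trans h0) (hty0 _ hw)
  have hS2 : ∀ v, v ∈ S → v 2 = 0 → ∃ w, w ≠ 0 ∧ v 0 = tx w ∧ v 1 = ty w := by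
    intro v hv h0
    rcases hS v hv with h | h | h | h
    · exact absurd h0 ((hC v).1 h.1).2.2
    · exact absurd h0 (hA1 v h).2.1
    · exact absurd h0 (hA2 v h).2.1
    · exact (hA3 v h).2
  have hSC : ∀ v, v ∈ S → v 0 ≠ 0 → v 1 ≠ 0 → v 2 ≠ 0 → v ∉ R1 ∧ v ∉ R2 := by
    intro v hv h0 h1 h2
    rcases hS v hv with h | h | h | h
    · exact h.2
    · exact absurd (hA1 v h).1 h0
    · exact absurd (hA2 v h).1 h1
    · exact absurd (hA3 v h).1 h2
  have hSR1 : ∀ v, v ∈ S → v 2 ≠ 0 → v 0 = sg (v 2) → v 1 = - sg (v 2) → False := by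
    intro v hv h2 h0 h1
    refine (hSC v hv ?_ ?_ h2).1 (Finset.mem_image.2 ⟨v 2, (hU _).2 h2, ?_⟩)
    · rw [h0]; exact hsg0 _ h2
    · rw [h1]; exact neg_ne_zero.2 (hsg0 _ h2)
    · ext i; fin_cases i <;> simp [h0, h1]
  have hSR2 : ∀ v, v ∈ S → v 2 ≠ 0 → v 0 = tx (v 2) → v 1 = ty (v 2) → False := by
    intro v hv h2 h0 h1
    refine (hSC v hv ?_ ?_ h2).2 (Finset.mem_image.2 ⟨v 2, (hU _).2 h2, ?_⟩)
    · rw [h0]; exact htx0 _ h2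
    · rw [h1]; exact hty0 _ h2
    · ext i; fin_cases i <;> simp [h0, h1]
  refine ⟨S, ?_, ?_⟩
  · rintro ⟨a, d, hd, hl⟩
    have hline : ∀ t : ZMod p, a + t • d ∈ S := by
      intro t
      have := hl t.val (ZMod.val_lt t)
      rwa [ZMod.natCast_zmod_val] at this
    have hval : ∀ (t : ZMod p) (i : Fin 3), (a + t • d) i = a i + t * d i := by
      intro t i; simp
    -- a parameter where coordinate `i` takes value `c`
    have hhit : ∀ (i : Fin 3) (c : ZMod p), d i ≠ 0 → ∃ t : ZMod p, a i + t * d i = c := by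
      intro i c hi
      exact ⟨(c - a i) / d i, by field_simp; ring⟩
    by_cases d0 : d 0 = 0
    · by_cases d1 : d 1 = 0
      · have d2 : d 2 ≠ 0 := by
          intro d2; apply hd; ext i; fin_cases i <;> simpa
        obtain ⟨t, h⟩ := hhit 2 0 d2
        obtain ⟨w, hw, h0, h1⟩ := hS2 _ (hline t) (by rw [hval, h])
        obtain ⟨t', h'⟩ := hhit 2 w d2
        simp only [hval, d0, d1, mul_zero, add_zero] at h0 h1
        refine hSR2 _ (hline t') ?_ ?_ ?_ <;> simp only [hval, h', d0, d1, mul_zero, add_zero] <;>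
          assumption
      · by_cases d2 : d 2 = 0
        · obtain ⟨t, h⟩ := hhit 1 0 d1
          obtain ⟨h2, h0⟩ := hS1 _ (hline t) (by rw [hval, h])
          simp only [hval, d0, d2, mul_zero, add_zero] at h0 h2
          obtain ⟨t', h'⟩ := hhit 1 (- sg (a 2)) d1
          refine hSR1 _ (hline t') ?_ ?_ ?_ <;>
            simp only [hval, h', d0, d2, mul_zero, add_zero] <;> assumption
        · obtain ⟨t, h⟩ := hhit 1 0 d1
          obtain ⟨h2, h0⟩ := hS1 _ (hline t) (by rw [hval, h])
          obtain ⟨t', h'⟩ := hhit 2 0 d2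
          obtain ⟨w, hw, h0', h1'⟩ := hS2 _ (hline t') (by rw [hval, h'])
          have e1 := (hsg _ h2).2
          have e2 := (htc _ hw).1
          rw [← h0] at e1
          rw [← h0'] at e2
          simp only [hval, d0, mul_zero, add_zero] at e1 e2
          rw [e1] at e2; norm_num at e2
    · by_cases d1 : d 1 = 0
      · by_cases d2 : d 2 = 0
        · obtain ⟨t, h⟩ := hhit 0 0 d0
          obtain ⟨h2, h0⟩ := hS0 _ (hline t) (by rw [hval, h])
          simp only [hval, d1, d2, mul_zero, add_zero] at h0 h2
          obtain ⟨t', h'⟩ := hhit 0 (sg (a 2)) d0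
          refine hSR1 _ (hline t') ?_ ?_ ?_ <;>
            simp only [hval, h', d1, d2, mul_zero, add_zero] <;> assumption
        · obtain ⟨t, h⟩ := hhit 0 0 d0
          obtain ⟨h2, h0⟩ := hS0 _ (hline t) (by rw [hval, h])
          obtain ⟨t', h'⟩ := hhit 2 0 d2
          obtain ⟨w, hw, h0', h1'⟩ := hS2 _ (hline t') (by rw [hval, h'])
          have e1 := hneg _ (hsg0 _ h2)
          rw [(hsg _ h2).2, ← h0] at e1
          have e2 := (htc _ hw).2
          rw [← h1'] at e2
          simp only [hval, d1, mul_zero, add_zero] at e1 e2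
          rw [e1] at e2; norm_num at e2
      · obtain ⟨t1, k1⟩ := hhit 0 0 d0
        obtain ⟨t2, k2⟩ := hhit 1 0 d1
        obtain ⟨g1, g2⟩ := hS0 _ (hline t1) (by rw [hval, k1])
        obtain ⟨f1, f2⟩ := hS1 _ (hline t2) (by rw [hval, k2])
        by_cases d2 : d 2 = 0
        · simp only [hval, d2, mul_zero, add_zero] at g1 g2 f1 f2
          obtain ⟨t, h⟩ := hhit 0 (tx (a 2)) d0
          refine hSR2 _ (hline t) ?_ ?_ ?_ <;> simp only [hval, h, d2, mul_zero, add_zero]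
          · exact g1
          · -- points lie on the line `x - y = sg`
            have e := hdiff _ g1
            have hx : sg (a 2) = (t2 - t1) * d 0 := by linear_combination k1 - f2
            have hy : sg (a 2) = (t2 - t1) * d 1 := by linear_combination g2 - k2
            have ht21 : t2 - t1 ≠ 0 := by
              intro h0; rw [h0, zero_mul] at hx; exact hsg0 _ g1 hx
            have hdd : d 0 = d 1 := mul_left_cancel₀ ht21 (hx.symm.trans hy)
            rw [hdd] at h k1
            linear_combination h - k1 + g2 + e
        · obtain ⟨t3, k3⟩ := hhit 2 0 d2
          obtain ⟨w, hw, m0, m1⟩ := hS2 _ (hline t3) (by rw [hval, k3])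
          simp only [hval] at g1 g2 f1 f2 m0 m1
          set w1 := a 2 + t1 * d 2 with hw1
          set w2 := a 2 + t2 * d 2 with hw2
          have key : tx w * w2 * sg w1 = ty w * w1 * sg w2 := by
            have x2 : sg w2 = (t2 - t1) * d 0 := by linear_combination k1 - f2
            have x3 : tx w = (t3 - t1) * d 0 := by linear_combination k1 - m0
            have y1 : sg w1 = (t2 - t1) * d 1 := by linear_combination g2 - k2
            have y3 : ty w = (t3 - t2) * d 1 := by linear_combination k2 - m1
            have z1 : w1 = (t1 - t3) * d 2 := by linear_combination k3 + hw1
            have z2 : w2 = (t2 - t3) * d 2 := by linear_combination k3 + hw2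
            rw [x2, x3, y1, y3, z1, z2]; ring
          have hne : w1 * w2 ≠ 0 := mul_ne_zero g1 f1
          have key2 : tx w = ty w ∨ tx w = - ty w := by
            rcases (hsg _ g1).1 with s1 | s1 <;> rcases (hsg _ f1).1 with s2 | s2 <;>
              rw [s1, s2] at key
            · left; apply mul_right_cancel₀ hne; linear_combination key
            · right; apply mul_right_cancel₀ hne; linear_combination key
            · right; apply mul_right_cancel₀ hne; linear_combination -key
            · left; apply mul_right_cancel₀ hne; linear_combination -key
          rcases ht w hw with ⟨q1, q2⟩ | ⟨q1, q2⟩ <;> rw [q1, q2] at key2 <;>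
            rcases key2 with q | q
          · exact hw (by linear_combination q)
          · exact mul_ne_zero h50 hw (by linear_combination -q)
          · exact hw (by linear_combination -q)
          · exact mul_ne_zero h50 hw (by linear_combination -q)
  · have cC : C.card = (p - 1) ^ 3 := by
      simp [C, Fintype.card_piFinset, hUc]
    have cR1 : R1.card ≤ p - 1 := hUc ▸ Finset.card_image_le
    have cR2 : R2.card ≤ p - 1 := hUc ▸ Finset.card_image_le
    have cA1 : A1.card = p - 1 := by
      rw [← hUc]; apply Finset.card_image_of_injective
      intro v w h
      simpa using congrFun h 2
    have cA2 : A2.card = p - 1 := by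
      rw [← hUc]; apply Finset.card_image_of_injective
      intro v w h
      simpa using congrFun h 2
    have cA3 : A3.card = p - 1 := by
      rw [← hUc]; apply Finset.card_image_of_injOn
      intro v hv w hw h
      have hv := (hU v).1 (by simpa using hv)
      have hw := (hU w).1 (by simpa using hw)
      have e0 : tx v = tx w := by simpa using congrFun h 0
      have e1 : ty v = ty w := by simpa using congrFun h 1
      rcases ht v hv with ⟨a1, a2⟩ | ⟨a1, a2⟩ <;> rcases ht w hw with ⟨b1, b2⟩ | ⟨b1, b2⟩ <;>
        rw [a1, b1] at e0 <;> rw [a2, b2] at e1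
      · linear_combination e0 - e1
      · exact absurd (show 5 * v = 0 by linear_combination 2 * e0 - 3 * e1) (mul_ne_zero h50 hv)
      · exact absurd (show 5 * v = 0 by linear_combination 2 * e1 - 3 * e0) (mul_ne_zero h50 hv)
      · linear_combination e1 - e0
    have dis1 : Disjoint A2 A3 := by
      rw [Finset.disjoint_left]
      intro v h h'
      exact (hA2 v h).2.1 (hA3 v h').1
    have dis2 : Disjoint A1 (A2 ∪ A3) := by
      rw [Finset.disjoint_left]
      intro v h h'
      obtain ⟨z0, z2, z1⟩ := hA1 v h
      rcases Finset.mem_union.1 h' with h' | h'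
      · exact hsg0 _ z2 ((hA2 v h').2.2.symm.trans z0)
      · exact z2 (hA3 v h').1
    have dis3 : Disjoint (C \ (R1 ∪ R2)) (A1 ∪ (A2 ∪ A3)) := by
      rw [Finset.disjoint_left]
      intro v h h'
      obtain ⟨z0, z1, z2⟩ := (hC v).1 (Finset.mem_sdiff.1 h).1
      rcases Finset.mem_union.1 h' with h' | h'
      · exact z0 (hA1 v h').1
      rcases Finset.mem_union.1 h' with h' | h'
      · exact z1 (hA2 v h').1
      · exact z2 (hA3 v h').1
    have cS : S.card = (C \ (R1 ∪ R2)).card + (A1.card + (A2.card + A3.card)) := by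
      rw [← Finset.card_union_of_disjoint dis1, ← Finset.card_union_of_disjoint dis2,
        ← Finset.card_union_of_disjoint dis3]
    have c1 : C.card - (R1 ∪ R2).card ≤ (C \ (R1 ∪ R2)).card := Finset.le_card_sdiff _ _
    have c2 := Finset.card_union_le R1 R2
    have hfin : (p - 1) ^ 3 + (p - 1) ≤ S.card := by
      rw [← cC]; omega
    have hp1 : 1 ≤ p := hp.one_lt.le
    zify [hp1] at hfin
    exact hfin
end

section
/- Let p ≥ 3 be a prime. Then every p-progression-free subset S of F_p^3 satisfies |S| ≤ p^3 - 2p^2 - (√2 - 1)p + 2, where √2 denotes the real square root of 2. -/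
open Matrix in
lemma exists_dir {F : Type*} [Field F] (n a : Fin 3 → F) :
    ∃ d : Fin 3 → F, d ≠ 0 ∧ n ⬝ᵥ d = 0 ∧ a ⬝ᵥ d = 0 := by
  have h : (Matrix.of ![n, a, 0]).det = 0 := by
    apply Matrix.det_eq_zero_of_row_eq_zero 2
    intro j
    simp
  obtain ⟨v, hv, hv2⟩ := Matrix.exists_mulVec_eq_zero_iff.mpr h
  refine ⟨v, hv, ?_, ?_⟩
  · simpa [Matrix.mulVec] using congrFun hv2 0
  · simpa [Matrix.mulVec] using congrFun hv2 1

/-- `T` meets every affine line. -/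
def Blocking {F : Type*} [Field F] (T : Finset (Fin 3 → F)) : Prop :=
  ∀ a d : Fin 3 → F, d ≠ 0 → ∃ c : F, a + c • d ∈ T

open Matrix in
lemma exists_point {F : Type*} [Field F] (T : Finset (Fin 3 → F)) (hT : Blocking T)
    (n a x : Fin 3 → F) : ∃ t ∈ T, n ⬝ᵥ t = n ⬝ᵥ x ∧ a ⬝ᵥ t = a ⬝ᵥ x := by
  obtain ⟨d, hd, h1, h2⟩ := exists_dir n a
  obtain ⟨c, hc⟩ := hT x d hd
  exact ⟨_, hc, by simp [dotProduct_add, h1], by simp [dotProduct_add, h2]⟩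

open Matrix MvPolynomial in
lemma totalDegree_lin {F : Type*} [Field F] (v : Fin 3 → F) :
    (∑ i, C (v i) * X i : MvPolynomial (Fin 3) F).totalDegree ≤ 1 := by
  apply totalDegree_finsetSum_le
  intro i _
  refine (totalDegree_mul _ _).trans ?_
  simp

open Matrix MvPolynomial in
lemma eval_lin {F : Type*} [Field F] (v a : Fin 3 → F) :
    eval a (∑ i, C (v i) * X i : MvPolynomial (Fin 3) F) = a ⬝ᵥ v := by
  simp [dotProduct, mul_comm]

open Matrix MvPolynomial in
lemma plane_bound {F : Type*} [Field F] [Fintype F] [DecidableEq F]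
    (T : Finset (Fin 3 → F)) (hT : Blocking T)
    (n : Fin 3 → F) (hn : n ≠ 0) (c : F) :
    2 * Fintype.card F - 1 ≤ (T.filter (fun t => n ⬝ᵥ t = c)).card := by
  set q := Fintype.card F with hq
  have hq2 : 1 < q := Fintype.one_lt_card
  obtain ⟨w, hw⟩ : ∃ w, n ⬝ᵥ w = 1 := by
    obtain ⟨i, hi⟩ := Function.ne_iff.mp hn
    exact ⟨Pi.single i (n i)⁻¹, by simpa using mul_inv_cancel₀ hi⟩
  obtain ⟨t₀, ht₀, h0, -⟩ := exists_point T hT n n (c • w)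
  have h0c : n ⬝ᵥ t₀ = c := by simpa [hw] using h0
  set P := T.filter (fun t => n ⬝ᵥ t = c) with hP
  have ht₀P : t₀ ∈ P := by simp [hP, ht₀, h0c]
  let f : MvPolynomial (Fin 3) F :=
    (1 - (∑ i, C (w i) * X i) ^ (q - 1)) *
      ∏ t ∈ P.erase t₀, (1 - ∑ i, C ((t - t₀) i) * X i)
  have hev : ∀ a, eval a f = (1 - (a ⬝ᵥ w) ^ (q - 1)) *
      ∏ t ∈ P.erase t₀, (1 - a ⬝ᵥ (t - t₀)) := by
    intro a
    simp only [f, map_mul, map_sub, map_one, map_pow, map_prod, eval_lin]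
  have hz : ∀ a, a ≠ 0 → eval a f = 0 := by
    intro a ha
    rw [hev]
    by_cases haw : a ⬝ᵥ w = 0
    · obtain ⟨i, hi⟩ := Function.ne_iff.mp ha
      let z : Fin 3 → F := Pi.single i (a i)⁻¹
      have hz : a ⬝ᵥ z = 1 := by simpa [z] using mul_inv_cancel₀ hi
      obtain ⟨t, ht, h1, h2⟩ := exists_point T hT n a (t₀ + (z - (n ⬝ᵥ z) • w))
      have h1' : n ⬝ᵥ t = c := by
        rw [h1]; simp [dotProduct_add, dotProduct_sub, hw, h0c]
      have h2' : a ⬝ᵥ t = a ⬝ᵥ t₀ + 1 := by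
        rw [h2]; simp [dotProduct_add, dotProduct_sub, haw, hz]
      have hne : t ≠ t₀ := by
        rintro rfl
        simp at h2'
      rw [Finset.prod_eq_zero (i := t), mul_zero]
      · simp [hP, hne, ht, h1']
      · rw [dotProduct_sub, h2']; ring
    · rw [FiniteField.pow_card_sub_one_eq_one _ haw]; simp
  have hsum : ∑ a, eval a f = 1 := by
    rw [Finset.sum_eq_single 0 (fun a _ ha => hz a ha) (by simp), hev]
    simp [zero_pow (show q - 1 ≠ 0 by omega)]
  have hdeg : f.totalDegree ≤ (q - 1) + (P.erase t₀).card := by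
    refine (totalDegree_mul _ _).trans (add_le_add ?_ ?_)
    · refine (totalDegree_sub _ _).trans ?_
      simp only [totalDegree_one, zero_le, sup_of_le_right]
      refine (totalDegree_pow _ _).trans ?_
      have := totalDegree_lin w
      nlinarith
    · refine (totalDegree_finsetProd _ _).trans ?_
      refine (Finset.sum_le_card_nsmul _ _ 1 ?_).trans (by simp)
      intro t _
      refine (totalDegree_sub _ _).trans ?_
      simp only [totalDegree_one, zero_le, sup_of_le_right]
      exact totalDegree_lin _
  by_contra hlt
  have hc := Finset.card_erase_of_mem ht₀P
  have hpos := Finset.card_pos.mpr ⟨_, ht₀P⟩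
  have := MvPolynomial.sum_eval_eq_zero f (by
    rw [Fintype.card_fin, ← hq]; omega)
  rw [hsum] at this
  exact one_ne_zero this

open Matrix in
lemma card_perp {F : Type*} [Field F] [Fintype F] [DecidableEq F]
    (d : Fin 3 → F) :
    Fintype.card F ^ 2 ≤ (Finset.univ.filter (fun n : Fin 3 → F => n ⬝ᵥ d = 0)).card := by
  have hle : Fintype.card (Fin 3 → F) ≤
      (Finset.univ.filter (fun n : Fin 3 → F => n ⬝ᵥ d = 0)).card * (Finset.univ : Finset F).card := by
    rw [← Finset.card_univ (α := Fin 3 → F)]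
    apply Finset.card_le_mul_card_image_of_maps_to (f := fun n => n ⬝ᵥ d) (by simp)
    intro b _
    by_cases h : ∃ m : Fin 3 → F, m ⬝ᵥ d = b
    · obtain ⟨m, hm⟩ := h
      apply Finset.card_le_card_of_injOn (fun n => n - m)
      · intro n hn
        simp at hn
        simp [sub_dotProduct, hn, hm]
      · intro x _ y _ h
        simpa using h
    · push Not at h
      simp [h]
  simp only [Fintype.card_fun, Fintype.card_fin, Finset.card_univ] at hle
  have : 0 < Fintype.card F := Fintype.card_pos
  nlinarith

open Matrix in
lemma pairs_count {F : Type*} [Field F] [Fintype F] [DecidableEq F]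
    (T : Finset (Fin 3 → F)) (n : Fin 3 → F) :
    ∑ c : F, (T.filter (fun t => n ⬝ᵥ t = c)).card ^ 2 =
      ∑ s ∈ T, ∑ t ∈ T, if n ⬝ᵥ (s - t) = 0 then 1 else 0 := by
  have : ∀ s t : Fin 3 → F, (if n ⬝ᵥ (s - t) = 0 then 1 else 0) =
      ∑ c : F, (if n ⬝ᵥ s = c then 1 else 0) * (if n ⬝ᵥ t = c then 1 else 0) := by
    intro s t
    simp only [dotProduct_sub, sub_eq_zero]
    simp [eq_comm]
  simp_rw [this, Finset.card_filter, sq, Finset.sum_mul_sum]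
  rw [Finset.sum_comm]
  refine Finset.sum_congr rfl fun s _ => ?_
  rw [Finset.sum_comm]

open Matrix in
lemma main_ineq {F : Type*} [Field F] [Fintype F] [DecidableEq F]
    (T : Finset (Fin 3 → F)) (hT : Blocking T) (q N e : ℝ) (hq : q = Fintype.card F)
    (hN : N = T.card) (he : e = N - q * (2 * q - 1)) :
    0 ≤ e ∧ N * q ^ 3 + N * (N - 1) * q ^ 2 - N ^ 2 ≤
      (q ^ 3 - 1) * (e ^ 2 + 2 * (2 * q - 1) * e + q * (2 * q - 1) ^ 2) := by
  set M : (Fin 3 → F) → F → ℝ := fun n c => ((T.filter (fun t => n ⬝ᵥ t = c)).card : ℝ) with hM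
  have hq1 : 1 ≤ Fintype.card F := Fintype.card_pos
  have hx : ∀ n, n ≠ 0 → ∀ c, 0 ≤ M n c - (2 * q - 1) := by
    intro n hn c
    have h := plane_bound T hT n hn c
    have h' : 2 * Fintype.card F ≤ (T.filter (fun t => n ⬝ᵥ t = c)).card + 1 := by omega
    have h2 : (2 * Fintype.card F : ℝ) ≤ (T.filter (fun t => n ⬝ᵥ t = c)).card + 1 := by
      exact_mod_cast h'
    simp only [hM, hq]; linarith
  have hsumM : ∀ n, ∑ c, M n c = N := by
    intro n
    rw [hN, Finset.card_eq_sum_card_fiberwise (f := fun t => n ⬝ᵥ t) (t := Finset.univ) (by simp)]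
    push_cast
    rfl
  have hsumx : ∀ n, ∑ c, (M n c - (2 * q - 1)) = e := by
    intro n
    rw [Finset.sum_sub_distrib, hsumM, he, hq]
    simp
    ring
  have he0 : 0 ≤ e := by
    rw [← hsumx 1]
    exact Finset.sum_nonneg fun c _ => hx 1 one_ne_zero c
  refine ⟨he0, ?_⟩
  have hsq : ∀ n, n ≠ 0 → ∑ c, M n c ^ 2 ≤
      e ^ 2 + 2 * (2 * q - 1) * e + q * (2 * q - 1) ^ 2 := by
    intro n hn
    have h1 : ∑ c, (M n c - (2 * q - 1)) ^ 2 ≤ e ^ 2 := by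
      rw [← hsumx n]
      exact Finset.sum_sq_le_sq_sum_of_nonneg fun c _ => hx n hn c
    have h2 : ∑ c, M n c ^ 2 = ∑ c, ((M n c - (2 * q - 1)) ^ 2 +
        2 * (2 * q - 1) * (M n c - (2 * q - 1)) + (2 * q - 1) ^ 2) :=
      Finset.sum_congr rfl fun c _ => by ring
    rw [h2, Finset.sum_add_distrib, Finset.sum_add_distrib, ← Finset.mul_sum, hsumx]
    simp only [Finset.sum_const, Finset.card_univ, nsmul_eq_mul, ← hq]
    linarith
  have h0 : ∑ c, M 0 c ^ 2 = N ^ 2 := by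
    rw [Finset.sum_eq_single 0]
    · simp [hM, hN]
    · intro c _ hc
      simp [hM, hc.symm]
    · simp
  have hup : ∑ n, ∑ c, M n c ^ 2 ≤ N ^ 2 +
      (q ^ 3 - 1) * (e ^ 2 + 2 * (2 * q - 1) * e + q * (2 * q - 1) ^ 2) := by
    rw [← Finset.add_sum_erase _ _ (Finset.mem_univ (0 : Fin 3 → F)), h0]
    gcongr
    refine (Finset.sum_le_card_nsmul _ _ _ fun n hn => hsq n (Finset.ne_of_mem_erase hn)).trans ?_
    rw [Finset.card_erase_of_mem (Finset.mem_univ _), nsmul_eq_mul, Finset.card_univ,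
      Nat.cast_sub Fintype.card_pos]
    simp [hq]
  have hlow : N * q ^ 3 + N * (N - 1) * q ^ 2 ≤ ∑ n, ∑ c, M n c ^ 2 := by
    have e1 : ∑ n, ∑ c, M n c ^ 2 = ∑ s ∈ T, ∑ t ∈ T,
        ((Finset.univ.filter (fun n : Fin 3 → F => n ⬝ᵥ (s - t) = 0)).card : ℝ) := by
      have : ∀ n, ∑ c, M n c ^ 2 = ∑ s ∈ T, ∑ t ∈ T, if n ⬝ᵥ (s - t) = 0 then (1:ℝ) else 0 := by
        intro n
        have := pairs_count T n
        simp only [hM]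
        exact_mod_cast this
      simp_rw [this]
      rw [Finset.sum_comm]
      refine Finset.sum_congr rfl fun s _ => ?_
      rw [Finset.sum_comm]
      refine Finset.sum_congr rfl fun t _ => ?_
      simp
    rw [e1]
    have e2 : ∀ s ∈ T, q ^ 3 + (N - 1) * q ^ 2 ≤ ∑ t ∈ T,
        ((Finset.univ.filter (fun n : Fin 3 → F => n ⬝ᵥ (s - t) = 0)).card : ℝ) := by
      intro s hs
      rw [← Finset.add_sum_erase _ _ hs]
      apply add_le_add
      · simp [hq]
      · have := Finset.card_nsmul_le_sum (T.erase s) (fun t =>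
          ((Finset.univ.filter (fun n : Fin 3 → F => n ⬝ᵥ (s - t) = 0)).card : ℝ)) (q ^ 2)
          (fun t _ => by rw [hq]; exact_mod_cast card_perp (s - t))
        rw [Finset.card_erase_of_mem hs, nsmul_eq_mul,
          Nat.cast_sub (Finset.card_pos.mpr ⟨s, hs⟩), ← hN] at this
        simpa using this
    have := Finset.card_nsmul_le_sum T _ _ e2
    rw [nsmul_eq_mul, ← hN] at this
    linarith
  linarith

lemma final_ineq (q N e r : ℝ) (hq : 3 ≤ q) (hr0 : 0 ≤ r) (hr : r ^ 2 = 2)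
    (he : N = q * (2 * q - 1) + e) (he0 : 0 ≤ e)
    (h : N * q ^ 3 + N * (N - 1) * q ^ 2 - N ^ 2 ≤
      (q ^ 3 - 1) * (e ^ 2 + 2 * (2 * q - 1) * e + q * (2 * q - 1) ^ 2)) :
    r * q - 2 ≤ e := by
  by_contra hlt
  push Not at hlt
  have key : q * (2 * q - 1) * (q - 1) ^ 2 + e * (q ^ 2 - 4 * q + 2) ≤ e ^ 2 * q ^ 2 := by
    have : 0 ≤ (q - 1) * (e ^ 2 * q ^ 2 -
        (q * (2 * q - 1) * (q - 1) ^ 2 + e * (q ^ 2 - 4 * q + 2))) := by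
      subst he
      linarith
    nlinarith [nonneg_of_mul_nonneg_right this (by linarith)]
  have r1 : 1.414 < r := by nlinarith
  have r2 : r < 1.415 := by nlinarith
  -- convexity in `e`
  have h1 : e * (e * q ^ 2 - (q ^ 2 - 4 * q + 2)) ≤
      e * ((r * q - 2) * q ^ 2 - (q ^ 2 - 4 * q + 2)) := by
    gcongr
  have hpos : 0 ≤ (r * q - 2) * q ^ 2 - (q ^ 2 - 4 * q + 2) := by nlinarith
  have h2 : e * ((r * q - 2) * q ^ 2 - (q ^ 2 - 4 * q + 2)) ≤
      (r * q - 2) * ((r * q - 2) * q ^ 2 - (q ^ 2 - 4 * q + 2)) := by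
    gcongr
  have h3 : (r * q - 2) * ((r * q - 2) * q ^ 2 - (q ^ 2 - 4 * q + 2)) =
      2 * q ^ 4 - 5 * r * q ^ 3 + (6 + 4 * r) * q ^ 2 - (8 + 2 * r) * q + 4 := by
    linear_combination q ^ 4 * hr
  have h4 : 0 < (5 * r - 5) * q ^ 3 - (2 + 4 * r) * q ^ 2 + (7 + 2 * r) * q - 4 := by
    have h5 : 0 ≤ (r - 1.414) * (5 * q ^ 3 - 4 * q ^ 2 + 2 * q) := by
      apply mul_nonneg (by linarith)
      nlinarith [sq_nonneg q]
    have h6 : 0 ≤ (q - 3) * q ^ 2 := by apply mul_nonneg; linarith; positivity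
    nlinarith
  nlinarith

theorem stmt_5 (p : ℕ) (hp : p.Prime) (hp3 : 3 ≤ p)
    (S : Finset (Fin 3 → ZMod p)) (hS : ProgFree p 3 p S) :
    (S.card : ℝ) ≤
      (p : ℝ) ^ 3 - 2 * (p : ℝ) ^ 2 - (Real.sqrt 2 - 1) * (p : ℝ) + 2 := by
  have : Fact p.Prime := ⟨hp⟩
  have hT : Blocking Sᶜ := by
    intro a d hd
    by_contra hcon
    push Not at hcon
    apply hS
    refine ⟨a, d, hd, fun i _ => ?_⟩
    simpa using hcon (i : ZMod p)
  have hcard : ((Sᶜ : Finset (Fin 3 → ZMod p)).card : ℝ) = (p : ℝ) ^ 3 - S.card := by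
    have := Finset.card_add_card_compl S
    simp only [Fintype.card_fun, Fintype.card_fin, ZMod.card] at this
    have h2 : (S.card : ℝ) + (Sᶜ : Finset (Fin 3 → ZMod p)).card = (p : ℝ) ^ 3 := by
      exact_mod_cast this
    linarith
  obtain ⟨h1, h2⟩ := main_ineq Sᶜ hT p _ _ (by rw [ZMod.card]) rfl rfl
  have := final_ineq p _ _ (Real.sqrt 2) (by exact_mod_cast hp3) (Real.sqrt_nonneg 2)
    (Real.sq_sqrt (by norm_num)) (by ring) h1 h2
  rw [hcard] at this
  linarith
end

section
/- Every 5-progression-free subset S of F_5^3 satisfies |S| ≤ 73 (i.e., r_5(F_5^3) < 74). -/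
namespace PF

instance fact5 : Fact (Nat.Prime 5) := ⟨by norm_num⟩

abbrev F := ZMod 5
abbrev V := F × F × F

/-- the bilinear form -/
def dot (u x : V) : F := u.1 * x.1 + u.2.1 * x.2.1 + u.2.2 * x.2.2

/-- the cross product -/
def cr (u x : V) : V :=
  (u.2.1 * x.2.2 - u.2.2 * x.2.1, u.2.2 * x.1 - u.1 * x.2.2, u.1 * x.2.1 - u.2.1 * x.1)

/-- normalized representatives of the 31 directions -/
def R : Finset V :=
  Finset.univ.filter fun v => v.1 = 1 ∨ (v.1 = 0 ∧ v.2.1 = 1) ∨ (v.1 = 0 ∧ v.2.1 = 0 ∧ v.2.2 = 1)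

lemma R_card : R.card = 31 := by decide +kernel

lemma R_dot : ∀ w : V, w ≠ 0 → (R.filter fun u => dot u w = 0).card = 6 := by decide +kernel

lemma R_cr : ∀ w : V, w ≠ 0 → (R.filter fun u => cr u w = 0).card = 1 := by decide +kernel

lemma R_ne : ∀ w ∈ R, w ≠ 0 := by decide +kernel

lemma R_par : ∀ v ∈ R, ∀ w : V, cr v w = 0 → ∃ t : F, w = t • v := by decide +kernel

lemma dot_smul (u v : V) (t : F) : dot u (t • v) = t * dot u v := by
  simp [dot]; ring

lemma dot_comm (u v : V) : dot u v = dot v u := by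
  simp [dot]; ring

lemma dot_add (u v w : V) : dot u (v + w) = dot u v + dot u w := by
  simp [dot]; ring

lemma dot_sub (u v w : V) : dot u (v - w) = dot u v - dot u w := by
  simp [dot]; ring

lemma dot_zero (u : V) : dot u 0 = 0 := by simp [dot]

lemma cr_zero (u : V) : cr u 0 = 0 := by simp [cr]

lemma R_pencil (v : V) (hv : v ∈ R) (w : V) :
    (R.filter fun u => dot u v = 0 ∧ dot u w = 0).card = if cr v w = 0 then 6 else 1 := by
  split_ifs with h
  · obtain ⟨t, rfl⟩ := R_par v hv w h
    rw [← R_dot v (R_ne v hv)]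
    congr 1
    apply Finset.filter_congr
    intro u _
    rw [dot_smul]
    constructor
    · exact fun h => h.1
    · intro h; simp [h]
  · rw [← R_cr _ h]
    congr 1
    apply Finset.filter_congr
    intro u hu
    constructor
    · rintro ⟨h1, h2⟩
      have : cr u (cr v w) = dot u w • v - dot u v • w := by
        ext <;> simp [cr, dot] <;> ring
      rw [this, h1, h2]; simp
    · intro h1
      obtain ⟨t, ht⟩ := R_par u hu _ h1
      have ht0 : t ≠ 0 := by
        rintro rfl
        apply h; rw [ht]; simp
      have a1 : dot v (cr v w) = 0 := by simp [cr, dot]; ring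
      have a2 : dot w (cr v w) = 0 := by simp [cr, dot]; ring
      rw [ht, dot_smul, dot_comm] at a1 a2
      simpa [ht0] using And.intro a1 a2

lemma R_plane (u : V) (w : V) (hw : w ≠ 0) :
    (R.filter fun v => dot u v = 0 ∧ cr v w = 0).card ≤ if dot u w = 0 then 1 else 0 := by
  split_ifs with h
  · rw [← R_cr w hw]
    apply Finset.card_le_card
    intro v
    simp only [Finset.mem_filter]
    tauto
  · simp only [nonpos_iff_eq_zero, Finset.card_eq_zero, Finset.filter_eq_empty_iff]
    rintro v hv ⟨h1, h2⟩
    obtain ⟨t, rfl⟩ := R_par v hv w h2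
    apply h; rw [dot_smul, h1]; simp

/-- every blocking set for the lines of the affine plane has at least 9 points -/
lemma plane_block (B : Finset (F × F))
    (hB : ∀ a d : F × F, d ≠ 0 → ∃ t : F, a + t • d ∈ B) : 9 ≤ B.card := by
  by_contra hlt
  push Not at hlt
  obtain ⟨t0, hb0⟩ := hB 0 (1, 0) (by decide)
  set b0 := (0 : F × F) + t0 • ((1, 0) : F × F) with hb0def
  clear_value b0
  let f : MvPolynomial (Fin 2) F := ∏ b ∈ B.erase b0,
    (MvPolynomial.C (b.1 - b0.1) * MvPolynomial.X 0
      + MvPolynomial.C (b.2 - b0.2) * MvPolynomial.X 1 - 1)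
  have hdeg : f.totalDegree ≤ 7 := by
    calc f.totalDegree ≤ ∑ b ∈ B.erase b0, (MvPolynomial.C (b.1 - b0.1) * MvPolynomial.X 0
      + MvPolynomial.C (b.2 - b0.2) * MvPolynomial.X 1 - 1 : MvPolynomial (Fin 2) F).totalDegree :=
          MvPolynomial.totalDegree_finsetProd _ _
      _ ≤ ∑ b ∈ B.erase b0, 1 := by
          apply Finset.sum_le_sum
          intro b _
          have key : ∀ (c : F) (i : Fin 2),
              (MvPolynomial.C c * MvPolynomial.X i : MvPolynomial (Fin 2) F).totalDegree ≤ 1 := by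
            intro c i
            refine (MvPolynomial.totalDegree_mul _ _).trans ?_
            simp
          refine (MvPolynomial.totalDegree_sub _ _).trans (max_le ?_ (by simp))
          exact (MvPolynomial.totalDegree_add _ _).trans (max_le (key _ _) (key _ _))
      _ ≤ 7 := by
          rw [Finset.sum_const, Finset.card_erase_of_mem hb0]
          simp; omega
  have hsum := MvPolynomial.sum_eval_eq_zero f (by
    simp only [Fintype.card_fin, ZMod.card]; omega)
  have heval : ∀ x : Fin 2 → F, MvPolynomial.eval x f =
      ∏ b ∈ B.erase b0, ((b.1 - b0.1) * x 0 + (b.2 - b0.2) * x 1 - 1) := by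
    intro x
    simp [f]
  rw [Finset.sum_eq_single (0 : Fin 2 → F)] at hsum
  · rw [heval, Finset.prod_eq_zero_iff] at hsum
    obtain ⟨b, _, hb⟩ := hsum
    simp at hb
  · intro x _ hx
    rw [heval]
    have hne : ((-x 1, x 0) : F × F) ≠ 0 := by
      intro h
      simp only [Prod.mk_eq_zero, neg_eq_zero] at h
      apply hx
      ext i
      fin_cases i
      · simpa using h.2
      · simpa using h.1
    have hp : ∃ p : F × F, p.1 * x 0 + p.2 * x 1 = 1 := by
      by_cases h0 : x 0 = 0
      · have h1 : x 1 ≠ 0 := by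
          intro h1; apply hne; simp [h0, h1]
        exact ⟨(0, (x 1)⁻¹), by simp [h1]⟩
      · exact ⟨((x 0)⁻¹, 0), by simp [h0]⟩
    obtain ⟨p, hp⟩ := hp
    obtain ⟨t, ht⟩ := hB (b0 + p) _ hne
    have hval : ((b0 + p + t • ((-x 1, x 0) : F × F)).1 - b0.1) * x 0
        + ((b0 + p + t • ((-x 1, x 0) : F × F)).2 - b0.2) * x 1 = 1 := by
      rw [← hp]; simp; ring
    apply Finset.prod_eq_zero (i := b0 + p + t • ((-x 1, x 0) : F × F))
    · rw [Finset.mem_erase]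
      refine ⟨?_, ht⟩
      intro h
      rw [h] at hval
      simp at hval
    · rw [hval]; simp
  · simp

lemma plane_free (T : Finset (F × F))
    (hT : ∀ a d : F × F, d ≠ 0 → ∃ t : F, a + t • d ∉ T) : T.card ≤ 16 := by
  have := plane_block Tᶜ (fun a d hd => by
    obtain ⟨t, ht⟩ := hT a d hd
    exact ⟨t, by simpa using ht⟩)
  rw [Finset.card_compl] at this
  simp only [Fintype.card_prod, ZMod.card] at this
  omega

/-- parametrization of planes -/
lemma R_param (u : V) (hu : u ∈ R) (c : F) : ∃ p v w : V,
    (∀ s t : F, s • v + t • w = 0 → s = 0 ∧ t = 0) ∧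
    ∀ x, dot u x = c → ∃ s t : F, x = p + (s • v + t • w) := by
  obtain ⟨u1, u2, u3⟩ := u
  simp only [R, Finset.mem_filter, Finset.mem_univ, true_and] at hu
  rcases hu with rfl | ⟨rfl, rfl⟩ | ⟨rfl, rfl, rfl⟩
  · refine ⟨(c, 0, 0), (-u2, 1, 0), (-u3, 0, 1), ?_, ?_⟩
    · intro s t h
      simp at h
      exact h.2
    · rintro ⟨x, y, z⟩ h
      refine ⟨y, z, ?_⟩
      simp [dot] at h
      simp [← h]; ring
  · refine ⟨(0, c, 0), (1, 0, 0), (0, -u3, 1), ?_, ?_⟩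
    · intro s t h
      simp at h
      tauto
    · rintro ⟨x, y, z⟩ h
      refine ⟨x, z, ?_⟩
      simp [dot] at h
      simp [← h]; ring
  · refine ⟨(0, 0, c), (1, 0, 0), (0, 1, 0), ?_, ?_⟩
    · intro s t h
      simp at h
      tauto
    · rintro ⟨x, y, z⟩ h
      refine ⟨x, y, ?_⟩
      simp [dot] at h
      simp [← h]

section main

/-- number of points of `S` in the plane `dot u x = c` -/
def n (S : Finset V) (u : V) (c : F) : ℕ := (S.filter fun x => dot u x = c).card

/-- number of points of `S` on the line through `x` in direction `v` -/
def k (S : Finset V) (x v : V) : ℕ := (S.filter fun y => cr v (y - x) = 0).card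

def LF (S : Finset V) : Prop := ∀ a d : V, d ≠ 0 → ∃ t : F, a + t • d ∉ S

lemma n_le (S : Finset V) (hS : LF S) (u : V) (hu : u ∈ R) (c : F) : n S u c ≤ 16 := by
  obtain ⟨p, v, w, hinj, hsurj⟩ := R_param u hu c
  let φ : F × F → V := fun q => p + (q.1 • v + q.2 • w)
  let T : Finset (F × F) := Finset.univ.filter fun q => φ q ∈ S
  have hT : T.card ≤ 16 := by
    apply plane_free
    intro a d hd
    obtain ⟨t, ht⟩ := hS (φ a) (d.1 • v + d.2 • w) (by
      intro h
      obtain ⟨h1, h2⟩ := hinj _ _ h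
      exact hd (Prod.ext h1 h2))
    refine ⟨t, ?_⟩
    simp only [T, Finset.mem_filter, Finset.mem_univ, true_and]
    have e : φ (a + t • d) = φ a + t • (d.1 • v + d.2 • w) := by
      ext <;> simp [φ] <;> ring
    rw [e]; exact ht
  refine le_trans ?_ hT
  refine le_trans (Finset.card_le_card ?_) (Finset.card_image_le (s := T) (f := φ))
  intro x hx
  rw [Finset.mem_filter] at hx
  obtain ⟨s, t, hst⟩ := hsurj x hx.2
  rw [Finset.mem_image]
  refine ⟨(s, t), ?_, hst.symm⟩
  simp only [T, Finset.mem_filter, Finset.mem_univ, true_and, φ]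
  rw [← hst]; exact hx.1

lemma k_le (S : Finset V) (hS : LF S) (x v : V) (hv : v ∈ R) : k S x v ≤ 4 := by
  obtain ⟨t, ht⟩ := hS x v (R_ne v hv)
  have : (S.filter fun y => cr v (y - x) = 0) ⊆
      (Finset.univ.erase t).image fun s : F => x + s • v := by
    intro y hy
    rw [Finset.mem_filter] at hy
    obtain ⟨s, hs⟩ := R_par v hv _ hy.2
    have hy' : y = x + s • v := by rw [← hs]; abel
    rw [Finset.mem_image]
    refine ⟨s, ?_, hy'.symm⟩
    rw [Finset.mem_erase]
    refine ⟨?_, Finset.mem_univ _⟩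
    rintro rfl
    exact ht (hy' ▸ hy.1)
  refine (Finset.card_le_card this).trans (Finset.card_image_le.trans ?_)
  rw [Finset.card_erase_of_mem (Finset.mem_univ _)]
  simp [ZMod.card]

lemma k_pos (S : Finset V) (x v : V) (hx : x ∈ S) : 1 ≤ k S x v := by
  apply Finset.card_pos.mpr
  exact ⟨x, by simp [hx, cr_zero]⟩

/-- swapping a double count -/
lemma swap_count {α β : Type*} (A : Finset α) (B : Finset β) (P : α → β → Prop)
    [∀ a b, Decidable (P a b)] :
    ∑ a ∈ A, (B.filter fun b => P a b).card = ∑ b ∈ B, (A.filter fun a => P a b).card := by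
  simp only [Finset.card_filter]
  exact Finset.sum_comm

lemma n_eq (S : Finset V) (u x : V) :
    n S u (dot u x) = (S.filter fun y => dot u (y - x) = 0).card := by
  unfold n
  simp only [dot_sub, sub_eq_zero]

lemma sum_k (S : Finset V) (x : V) (hx : x ∈ S) (hc : S.card = 74) :
    ∑ v ∈ R, k S x v = 104 := by
  unfold k
  rw [swap_count, ← Finset.add_sum_erase _ _ hx, Finset.sum_congr rfl (g := fun _ => 1)]
  · simp [cr_zero, R_card, Finset.card_erase_of_mem hx, hc]
  · intro y hy
    exact R_cr _ (sub_ne_zero.mpr (Finset.ne_of_mem_erase hy))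

lemma sum_n (S : Finset V) (x : V) (hx : x ∈ S) (hc : S.card = 74) :
    ∑ u ∈ R, n S u (dot u x) = 469 := by
  simp only [n_eq]
  rw [swap_count, ← Finset.add_sum_erase _ _ hx, Finset.sum_congr rfl (g := fun _ => 6)]
  · simp [dot_zero, R_card, Finset.card_erase_of_mem hx, hc]
  · intro y hy
    exact R_dot _ (sub_ne_zero.mpr (Finset.ne_of_mem_erase hy))

lemma sum_pencil (S : Finset V) (x v : V) (hv : v ∈ R) (hc : S.card = 74) :
    ∑ u ∈ R.filter (fun u => dot u v = 0), n S u (dot u x) = 74 + 5 * k S x v := by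
  simp only [n_eq]
  rw [swap_count]
  simp only [Finset.filter_filter, R_pencil v hv]
  unfold k
  rw [Finset.card_filter, Finset.mul_sum]
  nth_rewrite 1 [← hc]
  rw [Finset.card_eq_sum_ones, ← Finset.sum_add_distrib]
  apply Finset.sum_congr rfl
  intro y _
  split_ifs <;> rfl

lemma sum_in_plane (S : Finset V) (x u : V) (hx : x ∈ S) (hu : u ∈ R) :
    ∑ v ∈ R.filter (fun v => dot u v = 0), k S x v ≤ 5 + n S u (dot u x) := by
  rw [n_eq]
  unfold k
  rw [swap_count, Finset.card_filter, ← Finset.add_sum_erase _ _ hx,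
    ← Finset.add_sum_erase _ (fun y => if dot u (y - x) = 0 then 1 else 0) hx]
  have h6 : (R.filter fun v => dot u v = 0).card = 6 := by
    rw [← R_dot u (R_ne u hu)]
    simp only [dot_comm]
  have h1 : ((R.filter fun v => dot u v = 0).filter fun v => cr v (x - x) = 0).card = 6 := by
    simp [cr_zero, h6]
  rw [h1]
  have : ∑ y ∈ S.erase x, ((R.filter fun v => dot u v = 0).filter fun v => cr v (y - x) = 0).card
      ≤ ∑ y ∈ S.erase x, if dot u (y - x) = 0 then 1 else 0 := by
    apply Finset.sum_le_sum
    intro y hy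
    rw [Finset.filter_filter]
    exact R_plane u _ (sub_ne_zero.mpr (Finset.ne_of_mem_erase hy))
  simp only [sub_self, dot_zero, if_true]
  omega

/-- weight detecting planes with 15 or 14 points -/
def wt (m : ℕ) : ℕ := if m = 15 then 1 else if m = 14 then 2 else 0

lemma four_in_plane (S : Finset V) (x u : V) (hx : x ∈ S) (hu : u ∈ R)
    (hn : n S u (dot u x) ≤ 15) :
    ((R.filter fun v => k S x v = 4).filter fun v => dot u v = 0).card ≤ 4 := by
  have h := sum_in_plane S x u hx hu
  have h6 : (R.filter fun v => dot u v = 0).card = 6 := by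
    rw [← R_dot u (R_ne u hu)]
    simp only [dot_comm]
  have h2 : ∑ v ∈ R.filter (fun v => dot u v = 0), (1 + 3 * if k S x v = 4 then 1 else 0) ≤
      ∑ v ∈ R.filter (fun v => dot u v = 0), k S x v := by
    apply Finset.sum_le_sum
    intro v _
    have := k_pos S x v hx
    split_ifs <;> omega
  rw [Finset.sum_add_distrib, ← Finset.mul_sum, ← Finset.card_filter, ← Finset.card_eq_sum_ones,
    h6] at h2
  rw [Finset.filter_comm]
  omega

lemma many_four (S : Finset V) (hS : LF S) (x : V) (hx : x ∈ S) (hc : S.card = 74) :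
    11 ≤ (R.filter fun v => k S x v = 4).card := by
  have h := sum_k S x hx hc
  have h2 : ∑ v ∈ R, k S x v ≤ ∑ v ∈ R, (3 + if k S x v = 4 then 1 else 0) := by
    apply Finset.sum_le_sum
    intro v hv
    have := k_le S hS x v hv
    split_ifs <;> omega
  rw [Finset.sum_add_distrib, ← Finset.card_filter, Finset.sum_const, R_card] at h2
  simp only [smul_eq_mul] at h2
  omega

lemma pencil_wt (S : Finset V) (hS : LF S) (x v : V) (hv : v ∈ R) (hc : S.card = 74)
    (hk : k S x v = 4) :
    ∑ u ∈ R.filter (fun u => dot u v = 0), wt (n S u (dot u x)) = 2 := by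
  have h := sum_pencil S x v hv hc
  rw [hk] at h
  have hd : ∑ u ∈ R.filter (fun u => dot u v = 0), (16 - n S u (dot u x)) = 2 := by
    have : ∑ u ∈ R.filter (fun u => dot u v = 0), ((16 - n S u (dot u x)) + n S u (dot u x))
        = ∑ u ∈ R.filter (fun u => dot u v = 0), 16 := by
      apply Finset.sum_congr rfl
      intro u hu
      have := n_le S hS u (Finset.mem_filter.mp hu).1 (dot u x)
      omega
    rw [Finset.sum_add_distrib, h, Finset.sum_const, R_dot v (R_ne v hv)] at this
    simp only [smul_eq_mul] at this
    omega
  rw [← hd]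
  apply Finset.sum_congr rfl
  intro u hu
  have h1 := Finset.single_le_sum (f := fun u => 16 - n S u (dot u x))
    (fun i _ => Nat.zero_le _) hu
  rw [hd] at h1
  have h2 := n_le S hS u (Finset.mem_filter.mp hu).1 (dot u x)
  unfold wt
  split_ifs <;> omega

lemma wt_ge (S : Finset V) (hS : LF S) (x : V) (hx : x ∈ S) (hc : S.card = 74) :
    6 ≤ ∑ u ∈ R, wt (n S u (dot u x)) := by
  have h11 := many_four S hS x hx hc
  have h1 : ∑ v ∈ R.filter (fun v => k S x v = 4),
      ∑ u ∈ R, (if dot u v = 0 then wt (n S u (dot u x)) else 0) =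
      2 * (R.filter fun v => k S x v = 4).card := by
    rw [Finset.sum_congr rfl (g := fun _ => 2)]
    · simp [mul_comm]
    · intro v hv
      rw [Finset.mem_filter] at hv
      rw [← Finset.sum_filter]
      exact pencil_wt S hS x v hv.1 hc hv.2
  rw [Finset.sum_comm] at h1
  have h2 : ∑ u ∈ R, ∑ v ∈ R.filter (fun v => k S x v = 4),
      (if dot u v = 0 then wt (n S u (dot u x)) else 0) ≤ ∑ u ∈ R, 4 * wt (n S u (dot u x)) := by
    apply Finset.sum_le_sum
    intro u hu
    rw [← Finset.sum_filter, Finset.sum_const, smul_eq_mul]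
    by_cases hn : n S u (dot u x) ≤ 15
    · exact Nat.mul_le_mul_right _ (four_in_plane S x u hx hu hn)
    · have : wt (n S u (dot u x)) = 0 := by
        unfold wt
        split_ifs <;> omega
      simp [this]
  rw [← Finset.mul_sum] at h2
  omega

lemma class_sum (S : Finset V) (u : V) (g : ℕ → ℤ) :
    ∑ x ∈ S, g (n S u (dot u x)) = ∑ c : F, (n S u c : ℤ) * g (n S u c) := by
  rw [← Finset.sum_fiberwise S (fun x => dot u x)]
  apply Finset.sum_congr rfl
  intro c _
  rw [Finset.sum_congr rfl (g := fun _ => g (n S u c))]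
  · rw [Finset.sum_const, nsmul_eq_mul]; rfl
  · intro x hx
    rw [(Finset.mem_filter.mp hx).2]

lemma n_ge (S : Finset V) (hS : LF S) (hc : S.card = 74) (u : V) (hu : u ∈ R) (c : F) :
    10 ≤ n S u c := by
  have h := class_sum S u (fun _ => 1)
  simp only [Finset.sum_const, hc, mul_one, nsmul_eq_mul] at h
  have h2 : ∑ c' ∈ Finset.univ.erase c, (n S u c' : ℤ) ≤ ∑ c' ∈ (Finset.univ : Finset F).erase c, 16 := by
    apply Finset.sum_le_sum
    intro c' _
    exact_mod_cast n_le S hS u hu c'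
  rw [← Finset.add_sum_erase _ _ (Finset.mem_univ c)] at h
  rw [Finset.sum_const, Finset.card_erase_of_mem (Finset.mem_univ c)] at h2
  simp [ZMod.card] at h2 h
  omega

/-- the weight used in the final count -/
def g (m : ℕ) : ℤ := wt m - if m = 10 then 3 else 0

lemma g_ge (S : Finset V) (hS : LF S) (x : V) (hx : x ∈ S) (hc : S.card = 74) :
    -3 ≤ ∑ u ∈ R, g (n S u (dot u x)) := by
  have h1 := wt_ge S hS x hx hc
  have h2 := sum_n S x hx hc
  have h3 : ∑ u ∈ R, (n S u (dot u x) + wt (n S u (dot u x))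
      + 6 * if n S u (dot u x) = 10 then 1 else 0) ≤ ∑ u ∈ R, 16 := by
    apply Finset.sum_le_sum
    intro u hu
    have a1 := n_le S hS u hu (dot u x)
    unfold wt
    split_ifs <;> omega
  rw [Finset.sum_add_distrib, Finset.sum_add_distrib, ← Finset.mul_sum, h2, Finset.sum_const,
    R_card, smul_eq_mul] at h3
  have h4 : ∑ u ∈ R, g (n S u (dot u x)) = (∑ u ∈ R, wt (n S u (dot u x)) : ℕ)
      - 3 * (∑ u ∈ R, (if n S u (dot u x) = 10 then 1 else 0) : ℕ) := by
    push_cast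
    rw [Finset.mul_sum, ← Finset.sum_sub_distrib]
    apply Finset.sum_congr rfl
    intro u _
    unfold g
    split_ifs <;> simp
  rw [h4]
  omega

lemma no74 (S : Finset V) (hS : LF S) (hc : S.card = 74) : False := by
  have total : ∀ f : ℕ → ℤ, ∑ u ∈ R, ∑ c : F, (n S u c : ℤ) * f (n S u c) =
      ∑ x ∈ S, ∑ u ∈ R, f (n S u (dot u x)) := by
    intro f
    rw [Finset.sum_comm (s := S)]
    exact Finset.sum_congr rfl fun u _ => (class_sum S u f).symm
  have t1 : ∑ u ∈ R, ∑ c : F, (n S u c : ℤ) * 1 = 74 * 31 := by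
    rw [total fun _ => 1]
    simp [R_card, hc]
  have t2 : ∑ u ∈ R, ∑ c : F, (n S u c : ℤ) * (n S u c) = 74 * 469 := by
    rw [total fun m => m, Finset.sum_congr rfl (g := fun _ => (469 : ℤ))]
    · simp [hc]
    · intro x hx
      exact_mod_cast sum_n S x hx hc
  have t3 : -3 * 74 ≤ ∑ u ∈ R, ∑ c : F, (n S u c : ℤ) * g (n S u c) := by
    rw [total g]
    calc (-3 * 74 : ℤ) = ∑ x ∈ S, (-3) := by simp [hc]
      _ ≤ _ := Finset.sum_le_sum fun x hx => g_ge S hS x hx hc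
  have t0 : ∑ u ∈ R, ∑ c : F, (880 : ℤ) = 880 * 155 := by
    simp [R_card, ZMod.card]
  have main : ∑ u ∈ R, ∑ c : F, ((n S u c : ℤ) * g (n S u c) + 5 * ((n S u c : ℤ) * (n S u c))
      - 135 * ((n S u c : ℤ) * 1) + 880) ≤ ∑ u ∈ R, ∑ c : F, 0 := by
    apply Finset.sum_le_sum
    intro u hu
    apply Finset.sum_le_sum
    intro c _
    have a1 := n_le S hS u hu c
    have a2 := n_ge S hS hc u hu c
    generalize n S u c = m at a1 a2
    interval_cases m <;> simp [g, wt]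
  simp only [Finset.sum_add_distrib, Finset.sum_sub_distrib, ← Finset.mul_sum] at main
  simp only [Finset.sum_const_zero] at main
  simp only [mul_one] at *
  rw [t0, t1, t2] at main
  omega

end main

end PF

theorem stmt_6 (S : Finset (Fin 3 → ZMod 5)) (hS : ProgFree 5 3 5 S) :
    S.card ≤ 73 := by
  by_contra hlt
  push Not at hlt
  obtain ⟨T, hTS, hT⟩ := Finset.exists_subset_card_eq (show 74 ≤ S.card from hlt)
  let ψ : (Fin 3 → ZMod 5) → PF.V := fun x => (x 0, x 1, x 2)
  have hψ : Function.Injective ψ := by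
    intro x y h
    simp only [ψ, Prod.mk.injEq] at h
    ext i
    fin_cases i
    · simp [h.1]
    · simp [h.2.1]
    · simp [h.2.2]
  refine PF.no74 (T.image ψ) ?_ (by rw [Finset.card_image_of_injective _ hψ, hT])
  intro a d hd
  by_contra hcon
  push Not at hcon
  apply hS
  refine ⟨![a.1, a.2.1, a.2.2], ![d.1, d.2.1, d.2.2], ?_, ?_⟩
  · intro h
    apply hd
    have h0 := congrFun h 0
    have h1 := congrFun h 1
    have h2 := congrFun h 2
    simp at h0 h1 h2
    exact Prod.ext h0 (Prod.ext h1 h2)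
  · intro i _
    obtain ⟨y, hy, hyeq⟩ := Finset.mem_image.mp (hcon (i : ZMod 5))
    apply hTS
    convert hy using 1
    apply hψ
    rw [hyeq]
    simp [ψ]
    rfl
end

section
/- Every 7-progression-free subset S of F_7^3 satisfies |S| ≤ 242 (i.e., r_7(F_7^3) < 243). -/
set_option linter.constructorNameAsVariable false

open Finset

namespace LineFree

instance fact7 : Fact (Nat.Prime 7) := ⟨by norm_num⟩

/-- The field with seven elements. -/
abbrev K := ZMod 7
/-- The ambient space. -/
abbrev V := Fin 3 → K

/-- The purely combinatorial inequality for a weighted projective plane of order seven. -/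
theorem abstract_bound {α : Type*} (R : Finset α) (I : α → α → Prop)
    [∀ a b, Decidable (I a b)] (W E : α → ℤ)
    (hR : R.card = 57) (h8 : ∀ u ∈ R, (R.filter (fun d => I u d)).card = 8)
    (hA : ∑ d ∈ R, W d = 43)
    (hB : ∀ u ∈ R, ∑ d ∈ R with I u d, W d = 5 + E u)
    (hC : ∀ d ∈ R, ∑ u ∈ R with I u d, E u = 3 + 7 * W d)
    (hD : ∑ u ∈ R, E u = 59)
    (hW0 : ∀ d ∈ R, 0 ≤ W d) (hW5 : ∀ d ∈ R, W d ≤ 5)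
    (hE0 : ∀ d ∈ R, 0 ≤ E d) (hE9 : ∀ d ∈ R, E d ≤ 9) :
    ∑ u ∈ R, E u ^ 2 < 459 := by
  classical
  -- exchange of summation
  have swap : ∀ f : α → ℤ, ∑ u ∈ R, E u * (∑ d ∈ R with I u d, f d)
      = ∑ d ∈ R, f d * (3 + 7 * W d) := by
    intro f
    have h1 : ∀ d ∈ R, f d * (3 + 7 * W d) = ∑ u ∈ R, if I u d then E u * f d else 0 := by
      intro d hd
      rw [← hC d hd, mul_sum, sum_filter]
      refine sum_congr rfl fun u _ => ?_
      split_ifs <;> ring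
    rw [sum_congr rfl h1, sum_comm]
    refine sum_congr rfl fun u _ => ?_
    rw [mul_sum, sum_filter]
  have hEW : ∑ u ∈ R, E u ^ 2 = 7 * ∑ d ∈ R, W d ^ 2 - 166 := by
    have h := swap W
    have h1 : ∑ u ∈ R, E u * (∑ d ∈ R with I u d, W d) = ∑ u ∈ R, (5 * E u + E u ^ 2) := by
      refine sum_congr rfl fun u hu => ?_
      rw [hB u hu]; ring
    have h2 : ∑ d ∈ R, W d * (3 + 7 * W d) = ∑ d ∈ R, (3 * W d + 7 * W d ^ 2) :=
      sum_congr rfl fun d _ => by ring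
    rw [h1, h2, sum_add_distrib, sum_add_distrib, ← mul_sum, ← mul_sum, ← mul_sum, hA, hD] at h
    linarith
  by_contra hcon
  push Not at hcon
  let z : α → ℤ := fun d => if W d = 0 then 1 else 0
  -- number of zeros
  have hZ : 24 ≤ ∑ d ∈ R, z d := by
    have h1 : ∑ d ∈ R, W d ^ 2 ≤ ∑ d ∈ R, (6 * W d - 5 + 5 * z d) := by
      refine sum_le_sum fun d hd => ?_
      have h0 := hW0 d hd
      have h5 := hW5 d hd
      simp only [z]
      generalize W d = w at *
      interval_cases w <;> simp
    rw [sum_add_distrib, sum_sub_distrib, ← mul_sum, ← mul_sum, hA] at h1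
    simp only [sum_const, hR] at h1
    norm_num at h1
    omega
  have hEz := swap z
  have hEz' : ∑ d ∈ R, z d * (3 + 7 * W d) = 3 * ∑ d ∈ R, z d := by
    rw [mul_sum]
    refine sum_congr rfl fun d _ => ?_
    by_cases h : W d = 0 <;> simp [z, h]
  rw [hEz'] at hEz
  have key : ∑ u ∈ R, E u ^ 2 ≤ ∑ u ∈ R, (9 * E u - E u * (∑ d ∈ R with I u d, z d)) := by
    refine sum_le_sum fun u hu => ?_
    have e0 := hE0 u hu
    have e9 := hE9 u hu
    rcases e0.eq_or_lt with he | he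
    · simp [← he]
    suffices h : E u + ∑ d ∈ R with I u d, z d ≤ 9 by nlinarith
    by_cases hz : ∃ d ∈ R, I u d ∧ W d = 0
    · obtain ⟨d, hd, hud, hw⟩ := hz
      have e3 : E u ≤ 3 := by
        have h := hC d hd
        rw [hw] at h
        have := single_le_sum (f := E) (s := R.filter (fun u => I u d))
          (fun i hi => hE0 i (mem_filter.1 hi).1) (mem_filter.2 ⟨hu, hud⟩)
        linarith
      have h1 : ∑ d ∈ R with I u d, W d ≤ ∑ d ∈ R with I u d, (5 - 5 * z d) := by
        refine sum_le_sum fun d hd => ?_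
        have := hW5 d (mem_filter.1 hd).1
        by_cases h : W d = 0 <;> simp [z, h, this]
      rw [hB u hu, sum_sub_distrib, ← mul_sum, sum_const, h8 u hu] at h1
      norm_num at h1
      omega
    · push Not at hz
      have : ∑ d ∈ R with I u d, z d = 0 := by
        refine sum_eq_zero fun d hd => ?_
        have := hz d (mem_filter.1 hd).1 (mem_filter.1 hd).2
        simp [z, this]
      omega
  rw [sum_sub_distrib, hEz, ← mul_sum, hD] at key
  omega

/-- Standard representatives of the points of the projective plane. -/
def Rep : Finset V :=
  univ.filter fun v => v 0 = 1 ∨ (v 0 = 0 ∧ v 1 = 1) ∨ (v 0 = 0 ∧ v 1 = 0 ∧ v 2 = 1)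

/-- The nonzero vectors. -/
def NZ : Finset V := univ.filter fun v => v ≠ 0

theorem mem_NZ (v : V) : v ∈ NZ ↔ v ≠ 0 := by simp [NZ]

theorem rep_ne (v : V) (h : v ∈ Rep) : v ≠ 0 := by
  rintro rfl
  simp [Rep] at h

theorem rep_scalar (t t' : K) (v v' : V) (ht : t ≠ 0) (ht' : t' ≠ 0)
    (e0 : t * v 0 = t' * v' 0) (e1 : t * v 1 = t' * v' 1) (e2 : t * v 2 = t' * v' 2)
    (h : v 0 = 1 ∨ (v 0 = 0 ∧ v 1 = 1) ∨ (v 0 = 0 ∧ v 1 = 0 ∧ v 2 = 1))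
    (h' : v' 0 = 1 ∨ (v' 0 = 0 ∧ v' 1 = 1) ∨ (v' 0 = 0 ∧ v' 1 = 0 ∧ v' 2 = 1)) : t = t' := by
  rcases h with a | a | a <;> rcases h' with b | b | b <;> simp_all

theorem sum_rep (f : V → ℤ) (hf : ∀ (t : K) (v : V), t ≠ 0 → f (t • v) = f v) :
    ∑ v ∈ NZ, f v = 6 * ∑ v ∈ Rep, f v := by
  have h1 : ∑ p ∈ Rep ×ˢ (univ.filter fun t : K => t ≠ 0), f p.1 = ∑ v ∈ NZ, f v := by
    refine sum_nbij (fun p => p.2 • p.1) ?_ ?_ ?_ ?_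
    · rintro ⟨v, t⟩ h
      simp only [mem_product, mem_filter, mem_univ, true_and] at h
      rw [mem_NZ]
      exact smul_ne_zero h.2 (rep_ne v h.1)
    · rintro ⟨v, t⟩ h ⟨v', t'⟩ h' heq
      simp only [coe_product, Set.mem_prod, mem_coe, Rep, mem_filter, mem_univ, true_and] at h h'
      have e : ∀ i, t * v i = t' * v' i := fun i => by
        have := congrFun heq i
        simpa using this
      have e0 := e 0
      have e1 := e 1
      have e2 := e 2
      have ht := h.2
      have htt : t = t' := rep_scalar t t' v v' h.2 h'.2 e0 e1 e2 h.1 h'.1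
      subst htt
      have : v = v' := by
        funext i
        exact mul_left_cancel₀ ht (e i)
      rw [this]
    · intro v hv
      rw [mem_coe, mem_NZ] at hv
      have main : ∃ t : K, t ≠ 0 ∧ t⁻¹ • v ∈ Rep := by
        by_cases h0 : v 0 = 0
        · by_cases h1 : v 1 = 0
          · have h2 : v 2 ≠ 0 := by
              intro h2
              apply hv
              funext i
              fin_cases i <;> simp [h0, h1, h2]
            exact ⟨v 2, h2, by simp [Rep, h0, h1, h2]⟩
          · exact ⟨v 1, h1, by simp [Rep, h0, h1]⟩
        · exact ⟨v 0, h0, by simp [Rep, h0]⟩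
      obtain ⟨t, ht, hr⟩ := main
      refine ⟨(t⁻¹ • v, t), ?_, ?_⟩
      · simp [hr, ht]
      · simp [smul_smul, ht]
    · rintro ⟨v, t⟩ h
      simp only [mem_product, mem_filter, mem_univ, true_and] at h
      exact (hf t v h.2).symm
  have h6 : (univ.filter fun t : K => t ≠ 0).card = 6 := by
    rw [filter_ne', card_erase_of_mem (mem_univ _), card_univ, ZMod.card]
  rw [← h1, sum_product, mul_sum]
  refine sum_congr rfl fun v _ => ?_
  simp only [sum_const, h6]
  simp

theorem cross_zero (d v : V) (hd : d ≠ 0) (h : crossProduct d v = 0) : ∃ t : K, v = t • d := by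
  by_contra hc
  push Not at hc
  have := (crossProduct_ne_zero_iff_linearIndependent (v := d) (w := v)).2 ?_
  · exact this h
  · rw [LinearIndependent.pair_iff' hd]
    intro a ha
    exact hc a ha.symm

theorem card_plane (u : V) (hu : u ≠ 0) (c : K) :
    (univ.filter fun y : V => u ⬝ᵥ y = c).card = 49 := by
  obtain ⟨i, hi⟩ := Function.ne_iff.1 hu
  have hw : ∀ s : K, u ⬝ᵥ (Pi.single i (s * (u i)⁻¹) : V) = s := by
    intro s
    rw [dotProduct_single]
    field_simp [show u i ≠ 0 from hi]
  have heq : ∀ c' : K, (univ.filter fun y : V => u ⬝ᵥ y = c').card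
      = (univ.filter fun y : V => u ⬝ᵥ y = c).card := by
    intro c'
    refine card_nbij' (fun y => y + Pi.single i ((c - c') * (u i)⁻¹))
      (fun y => y - Pi.single i ((c - c') * (u i)⁻¹)) ?_ ?_ ?_ ?_
    · intro y hy
      simp only [coe_filter, mem_univ, true_and, Set.mem_ofPred_eq] at hy ⊢
      rw [dotProduct_add, hw, hy]; ring
    · intro y hy
      simp only [coe_filter, mem_univ, true_and, Set.mem_ofPred_eq] at hy ⊢
      rw [dotProduct_sub, hw, hy]; ring
    · intro y _; simp
    · intro y _; simp
  have htot := card_eq_sum_card_fiberwise (f := fun y : V => u ⬝ᵥ y) (s := univ) (t := univ)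
    (fun _ _ => by simp)
  rw [sum_congr rfl (fun c' _ => heq c')] at htot
  simp at htot
  omega

theorem card_two (d v : V) (hd : d ≠ 0) (h : ¬ ∃ t : K, v = t • d) :
    (univ.filter fun u : V => u ⬝ᵥ d = 0 ∧ u ⬝ᵥ v = 0).card = 7 := by
  have hn : crossProduct d v ≠ 0 := fun hc => h (cross_zero d v hd hc)
  have : (univ.filter fun u : V => u ⬝ᵥ d = 0 ∧ u ⬝ᵥ v = 0)
      = univ.image (fun t : K => t • crossProduct d v) := by
    ext u
    simp only [mem_filter, mem_univ, true_and, mem_image]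
    constructor
    · rintro ⟨h1, h2⟩
      have : crossProduct (crossProduct d v) u = 0 := by
        rw [cross_cross_eq_smul_sub_smul, dotProduct_comm d u, dotProduct_comm v u, h1, h2]
        simp
      obtain ⟨t, ht⟩ := cross_zero _ _ hn this
      exact ⟨t, ht.symm⟩
    · rintro ⟨t, rfl⟩
      rw [smul_dotProduct, smul_dotProduct, dotProduct_comm _ d, dotProduct_comm _ v]
      simp
  rw [this, card_image_of_injective]
  · simp
  · exact smul_left_injective K hn

theorem exists_perp (u : V) : ∃ d : V, d ≠ 0 ∧ u ⬝ᵥ d = 0 := by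
  by_cases h : u 0 = 0
  · exact ⟨Pi.single 0 1, by simp, by simp [h]⟩
  · refine ⟨![u 1, - u 0, 0], ?_, ?_⟩
    · intro hc
      have := congrFun hc 1
      simp at this
      exact h this
    · simp [dotProduct, Fin.sum_univ_three]
      ring

/-- Jamison's bound in each plane. -/
theorem plane_bound (B : Finset V) (hB : ∀ a d : V, d ≠ 0 → ∃ t : K, a + t • d ∈ B)
    (u : V) (hu : u ≠ 0) (c : K) : 13 ≤ (B.filter fun b => u ⬝ᵥ b = c).card := by
  obtain ⟨i, hi⟩ := Function.ne_iff.1 hu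
  have hi : u i ≠ 0 := hi
  -- a point of the plane in `B`
  obtain ⟨b0, hb0, hb0c⟩ : ∃ b ∈ B, u ⬝ᵥ b = c := by
    obtain ⟨d, hd, hud⟩ := exists_perp u
    obtain ⟨t, ht⟩ := hB (Pi.single i (c * (u i)⁻¹)) d hd
    refine ⟨_, ht, ?_⟩
    rw [dotProduct_add, dotProduct_smul, hud, dotProduct_single]
    field_simp
    simp
  set Q := (B.filter fun b => u ⬝ᵥ b = c).erase b0 with hQ
  have hQc : Q.card + 1 = (B.filter fun b => u ⬝ᵥ b = c).card :=
    card_erase_add_one (mem_filter.2 ⟨hb0, hb0c⟩)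
  by_contra hlt
  have hQ12 : Q.card < 12 := by omega
  let g : V → MvPolynomial (Fin 2) K := fun b =>
    1 - ∑ j, MvPolynomial.C ((b - b0) (i.succAbove j)) * MvPolynomial.X j
  have hdeg : ∀ b, (g b).totalDegree ≤ 1 := by
    intro b
    refine (MvPolynomial.totalDegree_sub _ _).trans ?_
    refine max_le (by simp) ?_
    refine MvPolynomial.totalDegree_finsetSum_le fun j _ => ?_
    refine (MvPolynomial.totalDegree_mul _ _).trans ?_
    rw [MvPolynomial.totalDegree_C, MvPolynomial.totalDegree_X]
  have hg : ∀ b (x : Fin 2 → K), MvPolynomial.eval x (g b)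
      = 1 - ∑ j, (b - b0) (i.succAbove j) * x j := by
    intro b x
    simp [g]
  have hsum := MvPolynomial.sum_eval_eq_zero (∏ b ∈ Q, g b) (by
    refine (MvPolynomial.totalDegree_finsetProd _ _).trans_lt ?_
    refine (sum_le_sum fun b _ => hdeg b).trans_lt ?_
    simpa using hQ12)
  rw [sum_eq_single (0 : Fin 2 → K)] at hsum
  · rw [MvPolynomial.eval_prod, prod_congr rfl (fun b _ => hg b 0)] at hsum
    simp at hsum
  · intro x _ hx
    rw [MvPolynomial.eval_prod]
    obtain ⟨j, hj⟩ := Function.ne_iff.1 hx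
    have hj : x j ≠ 0 := hj
    let y : V := i.insertNth 0 x
    have yi : y i = 0 := by simp [y]
    have yj : ∀ j, y (i.succAbove j) = x j := fun j => by simp [y]
    have hdir : crossProduct u y ≠ 0 := by
      intro hc
      obtain ⟨t, ht⟩ := cross_zero u y hu hc
      have h1 := congrFun ht i
      rw [yi] at h1
      have ht0 : t = 0 := by
        have h2 : t * u i = 0 := by simpa using h1.symm
        exact (mul_eq_zero.1 h2).resolve_right hi
      have h3 := congrFun ht (i.succAbove j)
      rw [yj, ht0] at h3
      exact hj (by simpa using h3)
    let a : V := Pi.single (i.succAbove j) (x j)⁻¹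
      + Pi.single i (-(u (i.succAbove j) * (x j)⁻¹ * (u i)⁻¹))
    have ha1 : u ⬝ᵥ a = 0 := by
      simp only [a, dotProduct_add, dotProduct_single]
      field_simp
      ring
    have ha2 : y ⬝ᵥ a = 1 := by
      simp only [a, dotProduct_add, dotProduct_single, yi, yj]
      field_simp
      simp
    obtain ⟨t, ht⟩ := hB (b0 + a) (crossProduct u y) hdir
    set b := b0 + a + t • crossProduct u y with hb
    have hbu : u ⬝ᵥ b = c := by
      rw [hb, dotProduct_add, dotProduct_add, dotProduct_smul, ha1, hb0c, dot_self_cross]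
      simp
    have hby : y ⬝ᵥ (b - b0) = 1 := by
      have : b - b0 = a + t • crossProduct u y := by rw [hb]; abel
      rw [this, dotProduct_add, dotProduct_smul, ha2, dot_cross_self]
      simp
    refine prod_eq_zero (i := b) ?_ ?_
    · rw [hQ, mem_erase]
      refine ⟨?_, mem_filter.2 ⟨ht, hbu⟩⟩
      intro hbb
      rw [hbb] at hby
      simp at hby
    · rw [hg]
      have : y ⬝ᵥ (b - b0) = ∑ j, (b - b0) (i.succAbove j) * x j := by
        rw [dotProduct, Fin.sum_univ_succAbove _ i, yi, zero_mul, zero_add]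
        refine sum_congr rfl fun j _ => ?_
        rw [yj, mul_comm]
      rw [← this, hby]
      ring
  · simp

/-- Number of points of `B` in a plane. -/
def xn (B : Finset V) (u : V) (c : K) : ℤ := ((B.filter fun b => u ⬝ᵥ b = c).card : ℤ)

/-- Number of points of `B` on a line. -/
def cnt (B : Finset V) (P d : V) : ℤ := ((univ.filter fun t : K => P + t • d ∈ B).card : ℤ)

theorem xn_eq (B : Finset V) (u : V) (c : K) :
    xn B u c = ∑ b ∈ B, if u ⬝ᵥ b = c then 1 else 0 := by
  simp [xn]

theorem sum_xn (B : Finset V) (u : V) : ∑ c, xn B u c = B.card := by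
  simp only [xn_eq]
  rw [sum_comm]
  simp

theorem card_perp_NZ (v : V) (hv : v ≠ 0) : (NZ.filter fun u => u ⬝ᵥ v = 0).card = 48 := by
  have h := card_plane v hv 0
  have : (NZ.filter fun u => u ⬝ᵥ v = 0) = (univ.filter fun y : V => v ⬝ᵥ y = 0).erase 0 := by
    ext u
    simp [NZ, dotProduct_comm]
  rw [this, card_erase_of_mem (by simp), h]

theorem card_two_NZ (d v : V) (hd : d ≠ 0) (h : ¬ ∃ t : K, v = t • d) :
    (NZ.filter fun u => u ⬝ᵥ d = 0 ∧ u ⬝ᵥ v = 0).card = 6 := by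
  have h := card_two d v hd h
  have : (NZ.filter fun u => u ⬝ᵥ d = 0 ∧ u ⬝ᵥ v = 0)
      = (univ.filter fun u : V => u ⬝ᵥ d = 0 ∧ u ⬝ᵥ v = 0).erase 0 := by
    ext u
    simp [NZ]
  rw [this, card_erase_of_mem (by simp), h]

theorem card_NZ : NZ.card = 342 := by
  have : NZ = (univ : Finset V).erase 0 := by
    ext u
    simp [NZ]
  rw [this, card_erase_of_mem (by simp)]
  simp

theorem card_nonzero : (univ.filter fun t : K => t ≠ 0).card = 6 := by
  rw [filter_ne', card_erase_of_mem (mem_univ _), card_univ, ZMod.card]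

theorem cnt_smul (B : Finset V) (P d : V) (s : K) (hs : s ≠ 0) :
    cnt B P (s • d) = cnt B P d := by
  unfold cnt
  congr 1
  refine card_nbij' (fun t => t * s) (fun t => t * s⁻¹) ?_ ?_ ?_ ?_
  · intro t ht
    simpa [smul_smul] using ht
  · intro t ht
    simpa [smul_smul, mul_assoc, hs] using ht
  · intro t _; simp [mul_assoc, hs]
  · intro t _; simp [mul_assoc, hs]

theorem xn_smul (B : Finset V) (P u : V) (s : K) (hs : s ≠ 0) :
    xn B (s • u) ((s • u) ⬝ᵥ P) = xn B u (u ⬝ᵥ P) := by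
  simp [xn, smul_dotProduct, hs]

/-- Summing line counts over the directions in a plane. -/
theorem sum_cnt (B : Finset V) (P : V) (hP : P ∉ B) (u : V) :
    ∑ d ∈ NZ with u ⬝ᵥ d = 0, cnt B P d = 6 * xn B u (u ⬝ᵥ P) := by
  have h1 : ∀ d ∈ NZ.filter (fun d => u ⬝ᵥ d = 0), cnt B P d
      = ∑ t ∈ univ.filter (fun t : K => t ≠ 0), if P + t • d ∈ B then (1 : ℤ) else 0 := by
    intro d _
    rw [cnt, sum_boole, filter_filter]
    congr 2
    ext t
    simp only [mem_filter, mem_univ, true_and]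
    constructor
    · intro h
      refine ⟨?_, h⟩
      rintro rfl
      simp at h
      exact hP h
    · exact fun h => h.2
  rw [sum_congr rfl h1, sum_comm]
  have h2 : ∀ t ∈ univ.filter (fun t : K => t ≠ 0),
      (∑ d ∈ NZ with u ⬝ᵥ d = 0, if P + t • d ∈ B then (1 : ℤ) else 0) = xn B u (u ⬝ᵥ P) := by
    intro t ht
    have ht : t ≠ 0 := (mem_filter.1 ht).2
    rw [sum_boole, filter_filter, xn]
    congr 1
    refine card_nbij' (fun d => P + t • d) (fun b => t⁻¹ • (b - P)) ?_ ?_ ?_ ?_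
    · intro d hd
      simp only [coe_filter, Set.mem_ofPred_eq] at hd ⊢
      exact ⟨hd.2.2, by simp [dotProduct_add, dotProduct_smul, hd.2.1]⟩
    · intro b hb
      simp only [coe_filter, Set.mem_ofPred_eq, mem_NZ] at hb ⊢
      refine ⟨?_, ?_, ?_⟩
      · refine smul_ne_zero (inv_ne_zero ht) ?_
        intro h
        rw [sub_eq_zero] at h
        exact hP (h ▸ hb.1)
      · simp [dotProduct_smul, dotProduct_sub, hb.2]
      · simpa [smul_smul, ht] using hb.1
    · intro d _; simp [smul_smul, ht]
    · intro b _; simp [smul_smul, ht]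
  rw [sum_congr rfl h2, sum_const, card_nonzero]
  simp

/-- Summing plane counts over the planes through a line. -/
theorem sum_planes_line (B : Finset V) (P d : V) (hd : d ≠ 0) :
    ∑ u ∈ NZ with u ⬝ᵥ d = 0, xn B u (u ⬝ᵥ P) = 6 * B.card + 42 * cnt B P d := by
  classical
  simp only [xn_eq]
  rw [sum_comm]
  have h1 : ∀ b ∈ B, (∑ u ∈ NZ with u ⬝ᵥ d = 0, if u ⬝ᵥ b = u ⬝ᵥ P then (1 : ℤ) else 0)
      = 6 + 42 * if (∃ t : K, b = P + t • d) then 1 else 0 := by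
    intro b _
    have h2 : (NZ.filter fun u => u ⬝ᵥ d = 0 ∧ u ⬝ᵥ b = u ⬝ᵥ P)
        = NZ.filter fun u => u ⬝ᵥ d = 0 ∧ u ⬝ᵥ (b - P) = 0 := by
      refine filter_congr fun u _ => ?_
      rw [dotProduct_sub, sub_eq_zero]
    rw [sum_boole, filter_filter, h2]
    by_cases hb : ∃ t : K, b = P + t • d
    · rw [if_pos hb]
      obtain ⟨t, rfl⟩ := hb
      have h3 : (NZ.filter fun u => u ⬝ᵥ d = 0 ∧ u ⬝ᵥ (P + t • d - P) = 0)
          = NZ.filter fun u => u ⬝ᵥ d = 0 := by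
        refine filter_congr fun u _ => ?_
        simp only [add_sub_cancel_left, dotProduct_smul]
        constructor
        · exact fun h => h.1
        · exact fun h => ⟨h, by simp [h]⟩
      rw [h3, card_perp_NZ d hd]
      norm_num
    · rw [if_neg hb, card_two_NZ d (b - P) hd]
      · norm_num
      · rintro ⟨t, ht⟩
        exact hb ⟨t, by rw [← ht]; abel⟩
  rw [sum_congr rfl h1, sum_add_distrib, ← mul_sum, sum_const, sum_boole]
  have h4 : ((B.filter fun b => ∃ t : K, b = P + t • d).card : ℤ) = cnt B P d := by
    rw [cnt]
    congr 1
    symm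
    refine card_nbij (fun t => P + t • d) ?_ ?_ ?_
    · intro t ht
      simp only [coe_filter, Set.mem_ofPred_eq, mem_univ, true_and] at ht ⊢
      exact ⟨ht, t, rfl⟩
    · intro t _ s _ h
      exact smul_left_injective K hd (add_left_cancel h)
    · rintro b hb
      simp only [coe_filter, Set.mem_ofPred_eq] at hb
      obtain ⟨hb, t, rfl⟩ := hb
      exact ⟨t, by simpa using hb, rfl⟩
  rw [h4]
  simp
  ring

theorem sum_planes_point (B : Finset V) (P : V) (hP : P ∉ B) :
    ∑ u ∈ NZ, xn B u (u ⬝ᵥ P) = 48 * B.card := by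
  simp only [xn_eq]
  rw [sum_comm]
  have h1 : ∀ b ∈ B, (∑ u ∈ NZ, if u ⬝ᵥ b = u ⬝ᵥ P then (1 : ℤ) else 0) = 48 := by
    intro b hb
    have h2 : (NZ.filter fun u => u ⬝ᵥ b = u ⬝ᵥ P) = NZ.filter fun u => u ⬝ᵥ (b - P) = 0 := by
      refine filter_congr fun u _ => ?_
      rw [dotProduct_sub, sub_eq_zero]
    rw [sum_boole, h2, card_perp_NZ]
    · norm_num
    · intro h
      rw [sub_eq_zero] at h
      exact hP (h ▸ hb)
  rw [sum_congr rfl h1, sum_const]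
  simp
  ring

/-- The second moment of the plane counts. -/
theorem sum_sq (B : Finset V) (hc : B.card = 100) :
    ∑ u ∈ NZ, ∑ c, xn B u c ^ 2 = 509400 := by
  have h1 : ∀ u ∈ NZ, ∑ c, xn B u c ^ 2
      = ∑ b ∈ B, ∑ b' ∈ B, if u ⬝ᵥ (b - b') = 0 then (1 : ℤ) else 0 := by
    intro u _
    have : ∀ c : K, xn B u c ^ 2
        = ∑ b ∈ B, ∑ b' ∈ B, if u ⬝ᵥ b = c then (if u ⬝ᵥ b' = c then (1 : ℤ) else 0) else 0 := by
      intro c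
      rw [sq, xn_eq, sum_mul_sum]
      refine sum_congr rfl fun b _ => sum_congr rfl fun b' _ => ?_
      split_ifs <;> simp
    simp only [this]
    rw [sum_comm]
    refine sum_congr rfl fun b _ => ?_
    rw [sum_comm]
    refine sum_congr rfl fun b' _ => ?_
    rw [sum_ite_eq]
    simp only [mem_univ, if_true, dotProduct_sub, sub_eq_zero]
    simp only [eq_comm]
  rw [sum_congr rfl h1, sum_comm]
  have h2 : ∀ b ∈ B, (∑ u ∈ NZ, ∑ b' ∈ B, if u ⬝ᵥ (b - b') = 0 then (1 : ℤ) else 0) = 5094 := by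
    intro b hb
    rw [sum_comm, ← add_sum_erase B _ hb]
    have h3 : ∀ b' ∈ B.erase b, (∑ u ∈ NZ, if u ⬝ᵥ (b - b') = 0 then (1 : ℤ) else 0) = 48 := by
      intro b' hb'
      rw [sum_boole, card_perp_NZ]
      · norm_num
      · exact sub_ne_zero.2 (ne_of_mem_erase hb').symm
    rw [sum_congr rfl h3, sum_const, card_erase_of_mem hb, hc]
    simp [card_NZ]
  rw [sum_congr rfl h2, sum_const, hc]
  norm_num

theorem sum_e_sq (B : Finset V) (hc : B.card = 100) :
    ∑ u ∈ NZ, ∑ c, (xn B u c - 13) ^ 2 = 24786 := by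
  have h1 : ∀ u ∈ NZ, ∑ c, (xn B u c - 13) ^ 2 = ∑ c, xn B u c ^ 2 - 1417 := by
    intro u _
    have h := sum_xn B u
    have : ∀ c : K, (xn B u c - 13) ^ 2 = xn B u c ^ 2 - 26 * xn B u c + 169 := fun c => by ring
    simp only [this, sum_add_distrib, sum_sub_distrib, ← mul_sum, h, hc]
    simp
    ring
  rw [sum_congr rfl h1, sum_sub_distrib, sum_sq B hc, sum_const, card_NZ]
  norm_num

theorem xn_compl (B : Finset V) (u : V) (hu : u ≠ 0) (c : K) :
    (((Bᶜ).filter fun P => u ⬝ᵥ P = c).card : ℤ) = 49 - xn B u c := by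
  have h := card_plane u hu c
  have h2 := card_filter_add_card_filter_not (s := univ.filter fun y : V => u ⬝ᵥ y = c) (fun y => y ∈ B)
  have h3 : (univ.filter fun y : V => u ⬝ᵥ y = c).filter (fun y => y ∈ B)
      = B.filter fun b => u ⬝ᵥ b = c := by
    ext y; simp [and_comm]
  have h4 : (univ.filter fun y : V => u ⬝ᵥ y = c).filter (fun y => ¬ y ∈ B)
      = (Bᶜ).filter fun b => u ⬝ᵥ b = c := by
    ext y; simp [and_comm]
  rw [h3, h4, h] at h2
  rw [xn]
  omega

theorem no_block (B : Finset V) (hB : ∀ a d : V, d ≠ 0 → ∃ t : K, a + t • d ∈ B)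
    (hc : B.card = 100) : False := by
  have hlow : ∀ u : V, u ≠ 0 → ∀ c, 13 ≤ xn B u c := fun u hu c => by
    have := plane_bound B hB u hu c
    rw [xn]
    exact_mod_cast this
  have hhigh : ∀ u : V, u ≠ 0 → ∀ c, xn B u c ≤ 22 := fun u hu c => by
    have h := sum_xn B u
    rw [← add_sum_erase univ _ (mem_univ c)] at h
    have h2 := card_nsmul_le_sum (univ.erase c) (fun c => xn B u c) 13 (fun c' _ => hlow u hu c')
    rw [card_erase_of_mem (mem_univ c), card_univ, ZMod.card] at h2
    rw [nsmul_eq_mul] at h2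
    push_cast at h2
    rw [hc] at h
    push_cast at h
    linarith
  -- averaging over the points outside `B`
  have havg : (243 * 2754 : ℤ) ≤ ∑ P ∈ Bᶜ, ∑ u ∈ NZ, (xn B u (u ⬝ᵥ P) - 13) ^ 2 := by
    rw [sum_comm]
    have h1 : ∀ u ∈ NZ, 27 * ∑ c, (xn B u c - 13) ^ 2
        ≤ ∑ P ∈ Bᶜ, (xn B u (u ⬝ᵥ P) - 13) ^ 2 := by
      intro u hu
      rw [mem_NZ] at hu
      rw [← sum_fiberwise (Bᶜ) (fun P => u ⬝ᵥ P), mul_sum]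
      refine sum_le_sum fun c _ => ?_
      have : ∑ P ∈ Bᶜ with u ⬝ᵥ P = c, (xn B u (u ⬝ᵥ P) - 13) ^ 2
          = (49 - xn B u c) * (xn B u c - 13) ^ 2 := by
        rw [← xn_compl B u hu c, ← nsmul_eq_mul, ← sum_const]
        refine sum_congr rfl fun P hP => ?_
        rw [(mem_filter.1 hP).2]
      rw [this]
      have := hhigh u hu c
      exact mul_le_mul_of_nonneg_right (by linarith) (sq_nonneg _)
    refine le_trans ?_ (sum_le_sum h1)
    rw [← mul_sum, sum_e_sq B hc]
    norm_num
  obtain ⟨P, hP, hPs⟩ : ∃ P ∈ Bᶜ, 2754 ≤ ∑ u ∈ NZ, (xn B u (u ⬝ᵥ P) - 13) ^ 2 := by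
    by_contra hcon
    push Not at hcon
    have h1 : ∑ P ∈ Bᶜ, ∑ u ∈ NZ, (xn B u (u ⬝ᵥ P) - 13) ^ 2 ≤ ∑ P ∈ Bᶜ, (2753 : ℤ) :=
      sum_le_sum fun P hP => by have := hcon P hP; omega
    have h2 : (Bᶜ).card = 243 := by
      rw [card_compl, hc]; simp
    rw [sum_const, h2] at h1
    norm_num at h1 havg
    linarith
  have hPB : P ∉ B := by simpa using hP
  -- pass to representatives
  have filt : ∀ (Q : V → Prop) [DecidablePred Q] (f : V → ℤ),
      (∀ (t : K) (v : V), t ≠ 0 → (Q (t • v) ↔ Q v)) →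
      (∀ (t : K) (v : V), t ≠ 0 → f (t • v) = f v) →
      ∑ v ∈ NZ with Q v, f v = 6 * ∑ v ∈ Rep with Q v, f v := by
    intro Q _ f hQ hf
    rw [sum_filter, sum_filter]
    refine sum_rep _ fun t v ht => ?_
    simp only [hQ t v ht, hf t v ht]
  have inv1 : ∀ (w : V) (t : K) (v : V), t ≠ 0 → (w ⬝ᵥ (t • v) = 0 ↔ w ⬝ᵥ v = 0) := by
    intro w t v ht
    simp [dotProduct_smul, ht]
  have inv2 : ∀ (w : V) (t : K) (v : V), t ≠ 0 → ((t • v) ⬝ᵥ w = 0 ↔ v ⬝ᵥ w = 0) := by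
    intro w t v ht
    simp [smul_dotProduct, ht]
  have invW : ∀ (t : K) (v : V), t ≠ 0 → cnt B P (t • v) - 1 = cnt B P v - 1 :=
    fun t v ht => by rw [cnt_smul B P v t ht]
  have invE : ∀ (t : K) (v : V), t ≠ 0 →
      xn B (t • v) ((t • v) ⬝ᵥ P) - 13 = xn B v (v ⬝ᵥ P) - 13 :=
    fun t v ht => by rw [xn_smul B P v t ht]
  have hR : Rep.card = 57 := by
    have h := sum_rep (fun _ => 1) (fun _ _ _ => rfl)
    simp [card_NZ] at h
    omega
  have hcard : ∀ u : V, u ≠ 0 → (NZ.filter fun d => u ⬝ᵥ d = 0).card = 48 := fun u hu => by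
    rw [← card_perp_NZ u hu]
    simp only [dotProduct_comm]
  have key := abstract_bound Rep (fun u d => u ⬝ᵥ d = 0) (fun d => cnt B P d - 1)
    (fun u => xn B u (u ⬝ᵥ P) - 13) hR ?_ ?_ ?_ ?_ ?_ ?_ ?_ ?_ ?_
  · have h := sum_rep (fun u => (xn B u (u ⬝ᵥ P) - 13) ^ 2)
      (fun t v ht => by simp only [invE t v ht])
    linarith
  · intro u hu
    have h := filt (fun d => u ⬝ᵥ d = 0) (fun _ => 1) (inv1 u) (fun _ _ _ => rfl)
    rw [sum_const, sum_const, hcard u (rep_ne u hu)] at h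
    simp at h
    omega
  · have h := sum_rep (fun d => cnt B P d - 1) invW
    have h2 := sum_cnt B P hPB 0
    simp [xn, hc] at h2
    rw [sum_sub_distrib, h2, sum_const, card_NZ] at h
    norm_num at h
    simp only [sum_sub_distrib, sum_const] at h ⊢
    norm_num at h ⊢
    linarith
  · intro u hu
    have h := filt (fun d => u ⬝ᵥ d = 0) (fun d => cnt B P d - 1) (inv1 u) invW
    rw [sum_sub_distrib, sum_cnt B P hPB u, sum_const, hcard u (rep_ne u hu)] at h
    norm_num at h ⊢
    linarith
  · intro d hd
    have h := filt (fun u => u ⬝ᵥ d = 0) (fun u => xn B u (u ⬝ᵥ P) - 13) (inv2 d) invE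
    rw [sum_sub_distrib, sum_planes_line B P d (rep_ne d hd), sum_const,
      card_perp_NZ d (rep_ne d hd), hc] at h
    norm_num at h ⊢
    linarith
  · have h := sum_rep (fun u => xn B u (u ⬝ᵥ P) - 13) invE
    rw [sum_sub_distrib, sum_planes_point B P hPB, sum_const, card_NZ, hc] at h
    norm_num at h ⊢
    linarith
  · intro d hd
    obtain ⟨t, ht⟩ := hB P d (rep_ne d hd)
    have : 0 < (univ.filter fun t : K => P + t • d ∈ B).card :=
      card_pos.2 ⟨t, by simpa using ht⟩
    simp only [cnt]
    omega
  · intro d _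
    have : (univ.filter fun t : K => P + t • d ∈ B).card
        ≤ (univ.filter fun t : K => t ≠ 0).card := by
      refine card_le_card fun t ht => ?_
      simp only [mem_filter, mem_univ, true_and] at ht ⊢
      rintro rfl
      simp at ht
      exact hPB ht
    rw [card_nonzero] at this
    simp only [cnt]
    omega
  · intro u hu
    have := hlow u (rep_ne u hu) (u ⬝ᵥ P)
    linarith
  · intro u hu
    have := hhigh u (rep_ne u hu) (u ⬝ᵥ P)
    linarith

end LineFree

theorem stmt_7 (S : Finset (Fin 3 → ZMod 7)) (hS : ProgFree 7 3 7 S) :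
    S.card ≤ 242 := by
  by_contra hlt
  push Not at hlt
  obtain ⟨T, hTS, hT⟩ := Finset.exists_subset_card_eq (show 243 ≤ S.card by omega)
  refine LineFree.no_block Tᶜ ?_ ?_
  · intro a d hd
    by_contra hcon
    push Not at hcon
    refine hS ⟨a, d, hd, fun i _ => hTS ?_⟩
    simpa using hcon (i : ZMod 7)
  · rw [Finset.card_compl, hT]
    simp
end

section
/- The maximum cardinality of a 6-progression-free subset of F_7^2 is exactly 29: there exists a subset of F_7^2 with 29 elements containing no 6 points in arithmetic progression, and every 6-progression-free subset of F_7^2 has at most 29 elements. -/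
namespace Stmt16

instance fact7 : Fact (Nat.Prime 7) := ⟨by norm_num⟩

open Polynomial in
lemma prod_univ : ((Finset.univ.val : Multiset (ZMod 7)).map (fun a => X - C a)).prod
    = (X ^ 7 - X : (ZMod 7)[X]) := by
  have hr := FiniteField.roots_X_pow_card_sub_X (ZMod 7)
  rw [ZMod.card] at hr
  rw [← hr]
  apply Polynomial.prod_multiset_X_sub_C_of_monic_of_roots_card_eq
  · exact monic_X_pow_sub (by rw [degree_X]; norm_num)
  · rw [hr, FiniteField.X_pow_card_sub_X_natDegree_eq _ (by norm_num)]
    simp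

/-- The sixth elementary symmetric function of a 19-element multiset covering
every residue at least twice is `-2`. -/
lemma esymm_eq (M : Multiset (ZMod 7)) (hM : M.card = 19) (h : ∀ c, 2 ≤ M.count c) :
    M.esymm 6 = -2 := by
  have hle : 2 • (Finset.univ.val : Multiset (ZMod 7)) ≤ M := by
    rw [Multiset.le_iff_count]
    intro c
    rw [Multiset.count_nsmul, Multiset.count_univ]
    simpa using h c
  obtain ⟨N, rfl⟩ := Multiset.le_iff_exists_add.1 hle
  have hN : N.card = 5 := by
    simp at hM
    omega
  have h1 := Multiset.prod_X_sub_C_coeff (2 • (Finset.univ.val : Multiset (ZMod 7)) + N)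
    (k := 13) (by omega)
  rw [hM] at h1
  norm_num at h1
  rw [← h1, Multiset.map_nsmul, Multiset.prod_nsmul, prod_univ]
  set g := (N.map (fun a => Polynomial.X - Polynomial.C a)).prod with hg
  have hd : g.natDegree = 5 := by
    rw [hg, Polynomial.natDegree_multiset_prod_X_sub_C_eq_card, hN]
  have hm : g.Monic := Polynomial.monic_multiset_prod_of_monic _ _
    (fun a _ => Polynomial.monic_X_sub_C a)
  have e : (Polynomial.X ^ 7 - Polynomial.X : Polynomial (ZMod 7)) ^ 2 * g
      = g * Polynomial.X ^ 14 - (g + g) * Polynomial.X ^ 8 + g * Polynomial.X ^ 2 := by ring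
  have h5 : g.coeff 5 = 1 := by rw [← hd]; exact hm
  have h11 : g.coeff 11 = 0 := Polynomial.coeff_eq_zero_of_natDegree_lt (by omega)
  rw [e, Polynomial.coeff_add, Polynomial.coeff_sub, Polynomial.coeff_mul_X_pow',
    Polynomial.coeff_mul_X_pow', Polynomial.coeff_mul_X_pow']
  norm_num [h5, h11]

lemma no19 (B : Finset (Fin 2 → ZMod 7)) (hB : B.card = 19)
    (h : ∀ u : Fin 2 → ZMod 7, u ≠ 0 → ∀ c : ZMod 7,
      2 ≤ (B.val.map (fun b => u 0 * b 0 + u 1 * b 1)).count c) : False := by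
  let F : MvPolynomial (Fin 2) (ZMod 7) := ∑ A ∈ B.powersetCard 6, ∏ b ∈ A,
    (MvPolynomial.X 0 * MvPolynomial.C (b 0) + MvPolynomial.X 1 * MvPolynomial.C (b 1))
  have hdeg : F.totalDegree ≤ 6 := by
    apply MvPolynomial.totalDegree_finsetSum_le
    intro A hA
    refine (MvPolynomial.totalDegree_finsetProd _ _).trans ?_
    rw [← (Finset.mem_powersetCard.1 hA).2, Finset.card_eq_sum_ones]
    apply Finset.sum_le_sum
    intro b _
    refine (MvPolynomial.totalDegree_add _ _).trans (max_le ?_ ?_) <;>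
    · refine (MvPolynomial.totalDegree_mul _ _).trans ?_
      simp
  have hev : ∀ u, MvPolynomial.eval u F
      = (B.val.map (fun b => u 0 * b 0 + u 1 * b 1)).esymm 6 := by
    intro u
    rw [Finset.esymm_map_val]
    simp [F, map_sum, map_prod]
  have h0 : MvPolynomial.eval 0 F = 0 := by
    simp only [F, map_sum, map_prod]
    apply Finset.sum_eq_zero
    intro A hA
    simp [(Finset.mem_powersetCard.1 hA).2]
  have hs := MvPolynomial.sum_eval_eq_zero F (by
    rw [ZMod.card, Fintype.card_fin]; omega)
  rw [← Finset.add_sum_erase _ _ (Finset.mem_univ 0), h0,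
    Finset.sum_congr rfl (g := fun _ => (-2 : ZMod 7)) (fun u hu => by
      rw [hev]
      exact esymm_eq _ (by simpa using hB) (h u (Finset.ne_of_mem_erase hu)))] at hs
  rw [Finset.sum_const, Finset.card_erase_of_mem (Finset.mem_univ _), Finset.card_univ] at hs
  simp at hs
  revert hs
  decide

lemma cover (S : Finset (Fin 2 → ZMod 7)) (hS : ProgFree 7 2 6 S)
    (u : Fin 2 → ZMod 7) (hu : u ≠ 0) (c : ZMod 7) :
    2 ≤ (Sᶜ.val.map (fun b => u 0 * b 0 + u 1 * b 1)).count c := by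
  by_contra hlt
  rw [Multiset.count_map] at hlt
  have hcard : (Sᶜ.filter (fun b => c = u 0 * b 0 + u 1 * b 1)).card ≤ 1 := by
    change Multiset.card (Multiset.filter _ _) ≤ 1
    omega
  rw [Finset.card_le_one] at hcard
  obtain ⟨p, hp⟩ : ∃ p : Fin 2 → ZMod 7, c = u 0 * p 0 + u 1 * p 1 := by
    by_cases h0 : u 0 = 0
    · have h1 : u 1 ≠ 0 := by
        intro h1
        apply hu
        ext i
        fin_cases i <;> simp [h0, h1]
      exact ⟨![0, c / u 1], by simp; field_simp⟩
    · exact ⟨![c / u 0, 0], by simp; field_simp⟩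
  let d : Fin 2 → ZMod 7 := ![- u 1, u 0]
  have hd : d ≠ 0 := by
    intro h
    have h0 := congrFun h 0
    have h1 := congrFun h 1
    simp [d] at h0 h1
    apply hu
    ext i
    fin_cases i <;> simp [h0, h1]
  have key : ∃ q : Fin 2 → ZMod 7, c = u 0 * q 0 + u 1 * q 1 ∧
      ∀ b ∉ S, c = u 0 * b 0 + u 1 * b 1 → b = q := by
    by_cases hex : ∃ q, q ∉ S ∧ c = u 0 * q 0 + u 1 * q 1
    · obtain ⟨q, hq, hqc⟩ := hex
      refine ⟨q, hqc, fun b hb hbc => hcard _ ?_ _ ?_⟩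
      · exact Finset.mem_filter.2 ⟨Finset.mem_compl.2 hb, hbc⟩
      · exact Finset.mem_filter.2 ⟨Finset.mem_compl.2 hq, hqc⟩
    · push Not at hex
      exact ⟨p, hp, fun b hb hbc => absurd hbc (hex b hb)⟩
  obtain ⟨q, hqc, hq⟩ := key
  apply hS
  refine ⟨q + d, d, hd, fun i hi => ?_⟩
  by_contra hmem
  have := hq _ hmem (by
    have e0 : d 0 = - u 1 := rfl
    have e1 : d 1 = u 0 := rfl
    simp only [Pi.add_apply, Pi.smul_apply, smul_eq_mul, e0, e1, hqc]; ring)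
  have h2 : ((i : ZMod 7) + 1) • d = 0 := by
    rw [add_smul, one_smul]
    have h3 : q + ((i : ZMod 7) • d + d) = q + 0 := by
      rw [add_zero]; nth_rewrite 2 [← this]; abel
    exact add_left_cancel h3
  rcases smul_eq_zero.1 h2 with h | h
  · interval_cases i <;> revert h <;> decide
  · exact hd h

def code : ℕ := 549388925426253

lemma code_ok : ∀ a b d e : ZMod 7, ¬ (d = 0 ∧ e = 0) → ∃ i : Fin 6,
    code.testBit (7 * (a + ((i : ℕ) : ZMod 7) * d).val + (b + ((i : ℕ) : ZMod 7) * e).val) = false := by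
  decide +kernel

end Stmt16

theorem stmt_16 :
    (∃ S : Finset (Fin 2 → ZMod 7), ProgFree 7 2 6 S ∧ S.card = 29) ∧
    (∀ S : Finset (Fin 2 → ZMod 7), ProgFree 7 2 6 S → S.card ≤ 29) := by
  constructor
  · refine ⟨Finset.univ.filter (fun v => Stmt16.code.testBit (7 * (v 0).val + (v 1).val) = true),
      ?_, by decide +kernel⟩
    rintro ⟨a, d, hd, h⟩
    obtain ⟨i, hi⟩ := Stmt16.code_ok (a 0) (a 1) (d 0) (d 1) (by
      rintro ⟨h0, h1⟩
      apply hd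
      ext i
      fin_cases i <;> simp [h0, h1])
    have := h i i.2
    rw [Finset.mem_filter] at this
    simp only [Pi.add_apply, Pi.smul_apply, smul_eq_mul] at this
    rw [hi] at this
    exact absurd this.2 (by simp)
  · intro S hS
    by_contra hlt
    obtain ⟨T, hTS, hT⟩ := Finset.exists_subset_card_eq (show 30 ≤ S.card by omega)
    have hTf : ProgFree 7 2 6 T := fun ⟨a, d, hd, h⟩ => hS ⟨a, d, hd, fun i hi => hTS (h i hi)⟩
    refine Stmt16.no19 Tᶜ ?_ (Stmt16.cover T hTf)
    rw [Finset.card_compl, hT]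
    simp
end
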